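/- arXiv:1608.05290 — 3 statements merged into one kernel-verified Lean document; each statement's English description precedes it below -/
import Mathlib

section
/- For every positive integer r and every pair of finite structures X = (X, P^X, L^X) and Y = (Y, P^Y, L^Y), where P^X (resp. P^Y) is a strict partial order on the finite set X (resp. Y) and L^X (resp. L^Y) is a strict linear order on the same set extending the partial order, there exists a finite structure Z = (Z, P^Z, L^Z) of the same kind such that: for every coloring of the set of copies of X in Z with r colors, there exists a copy Ỹ of Y in Z such that all copies of X inside Ỹ receive the same color. -/
/-- `π` is order preserving for the `PL^(1)` structures `(α, P, L)` and `(β, P', L')`. -/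
def OrderPres {α β : Type} (P L : α → α → Prop) (P' L' : β → β → Prop)
    (π : α → β) : Prop :=
  (∀ x y, P x y ↔ P' (π x) (π y)) ∧ (∀ x y, L x y ↔ L' (π x) (π y))

/-- `S` is a copy of the `PL^(1)` structure `(α, P, L)` in `(β, P', L')`:
it is the image of an order preserving map. -/
def IsCopy {α β : Type} (P L : α → α → Prop) (P' L' : β → β → Prop)
    (S : Set β) : Prop :=
  ∃ π : α → β, OrderPres P L P' L' π ∧ Set.range π = S

def RG : ℕ → ℕ → List ℕ → Prop
  | a, b, [] => a = b
  | a, b, x :: w => (x < a ∧ RG a b w) ∨ (x = a ∧ RG (a + 1) b w)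

def sg (a : ℕ) (g : List ℕ) (x : ℕ) : ℕ := if x < a then x else g.getD (x - a) 0

def sh (a : ℕ) (x : ℕ) : ℕ := if x < a then x else x + 1

theorem RG.le {a b : ℕ} {w : List ℕ} (h : RG a b w) : a ≤ b := by
  induction w generalizing a with
  | nil => exact le_of_eq h
  | cons x w ih =>
    rcases h with ⟨_, h⟩ | ⟨_, h⟩
    · exact ih h
    · have := ih h; omega

theorem RG.lt {a b : ℕ} {w : List ℕ} (h : RG a b w) : ∀ x ∈ w, x < b := by
  induction w generalizing a with
  | nil => simp
  | cons x w ih =>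
    intro y hy
    rcases h with ⟨h1, h⟩ | ⟨h1, h⟩
    · have := h.le
      rcases List.mem_cons.1 hy with rfl | hy
      · omega
      · exact ih h y hy
    · have := h.le
      rcases List.mem_cons.1 hy with rfl | hy
      · omega
      · exact ih h y hy

theorem RG_of_lt {a : ℕ} {w : List ℕ} (h : ∀ x ∈ w, x < a) : RG a a w := by
  induction w with
  | nil => rfl
  | cons x w ih =>
    exact Or.inl ⟨h x (by simp), ih fun y hy => h y (by simp [hy])⟩

theorem RG_line {a : ℕ} {w : List ℕ} (h : ∀ x ∈ w, x ≤ a) (h' : a ∈ w) : RG a (a + 1) w := by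
  induction w with
  | nil => simp at h'
  | cons x w ih =>
    by_cases hx : x = a
    · exact Or.inr ⟨hx, RG_of_lt fun y hy => Nat.lt_succ_of_le (h y (by simp [hy]))⟩
    · refine Or.inl ⟨lt_of_le_of_ne (h x (by simp)) hx, ih (fun y hy => h y (by simp [hy])) ?_⟩
      rcases List.mem_cons.1 h' with h' | h'
      · exact absurd h'.symm hx
      · exact h'

theorem RG.append {a b c : ℕ} {u v : List ℕ} (h : RG a b u) (h' : RG b c v) :
    RG a c (u ++ v) := by
  induction u generalizing a with
  | nil => cases h; exact h'
  | cons x w ih =>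
    rcases h with ⟨h1, h⟩ | ⟨h1, h⟩
    · exact Or.inl ⟨h1, ih h⟩
    · exact Or.inr ⟨h1, ih h⟩

theorem RG.shift {a s b : ℕ} {w : List ℕ} (has : a ≤ s) (h : RG s b w) :
    RG (s + 1) (b + 1) (w.map (sh a)) := by
  induction w generalizing s with
  | nil => cases h; rfl
  | cons x w ih =>
    rcases h with ⟨h1, h⟩ | ⟨h1, h⟩
    · refine Or.inl ⟨?_, ih has h⟩
      unfold sh; split_ifs <;> omega
    · refine Or.inr ⟨?_, ih (by omega) h⟩
      unfold sh; split_ifs <;> omega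

theorem RG.split {a b p : ℕ} {w : List ℕ} (h : RG a b w) (h1 : a ≤ p) (h2 : p < b) :
    ∃ u v, w = u ++ p :: v ∧ ∀ x ∈ u, x < p := by
  induction w generalizing a with
  | nil => cases h; omega
  | cons x w ih =>
    rcases h with ⟨h3, h⟩ | ⟨h3, h⟩
    · obtain ⟨u, v, rfl, hu⟩ := ih h h1
      refine ⟨x :: u, v, rfl, ?_⟩
      intro y hy
      rcases List.mem_cons.1 hy with rfl | hy
      · omega
      · exact hu y hy
    · by_cases hp : p = a
      · subst hp h3
        exact ⟨[], w, rfl, by simp⟩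
      · obtain ⟨u, v, rfl, hu⟩ := ih h (by omega)
        refine ⟨x :: u, v, rfl, ?_⟩
        intro y hy
        rcases List.mem_cons.1 hy with rfl | hy
        · omega
        · exact hu y hy

theorem RG.subst_aux {σ : ℕ → ℕ} {m c s b : ℕ} {f : List ℕ} (hf : RG c (c + m) f)
    (hg : RG s b ((List.range' c m).map σ)) (hσ : ∀ x < c, σ x < s) : RG s b (f.map σ) := by
  induction f generalizing c s m with
  | nil =>
    have h : c = c + m := hf
    have : m = 0 := by omega
    subst this
    exact hg
  | cons x w ih =>
    rcases hf with ⟨h1, h⟩ | ⟨h1, h⟩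
    · exact Or.inl ⟨hσ x h1, ih h hg hσ⟩
    · subst h1
      have := h.le
      obtain ⟨m, rfl⟩ : ∃ m', m = m' + 1 := ⟨m - 1, by omega⟩
      rw [List.range'_succ] at hg
      have h' : RG (x + 1) (x + 1 + m) w := by
        convert h using 1; omega
      rcases hg with ⟨h2, hg⟩ | ⟨h2, hg⟩
      · refine Or.inl ⟨h2, ih h' hg ?_⟩
        intro y hy
        rcases Nat.lt_succ_iff_lt_or_eq.1 hy with hy | rfl
        · exact hσ y hy
        · exact h2
      · refine Or.inr ⟨h2, ih h' hg ?_⟩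
        intro y hy
        rcases Nat.lt_succ_iff_lt_or_eq.1 hy with hy | rfl
        · exact Nat.lt_succ_of_lt (hσ y hy)
        · omega

theorem map_range_sg (a : ℕ) (g : List ℕ) : (List.range' a g.length).map (sg a g) = g := by
  apply List.ext_getElem
  · simp
  · intro i h1 h2
    simp [sg, h2]

theorem RG.subst {a b m : ℕ} {f g : List ℕ} (hf : RG a (a + m) f) (hm : g.length = m)
    (hg : RG a b g) : RG a b (f.map (sg a g)) := by
  subst hm
  apply RG.subst_aux hf
  · rw [map_range_sg]; exact hg
  · intro x hx; simp [sg, hx]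

theorem sg_comp {a m : ℕ} {f g h : List ℕ} (hf : ∀ x ∈ f, x < a + m) (hm : g.length = m) :
    (f.map (sg a g)).map (sg a h) = f.map (sg a (g.map (sg a h))) := by
  rw [List.map_map]
  apply List.map_congr_left
  intro x hx
  have := hf x hx
  by_cases hxa : x < a
  · simp [sg, hxa]
  · have h3 : x - a < g.length := by omega
    simp [sg, hxa, h3]

theorem hj_line (a : ℕ) (κ : Type) [Finite κ] : ∃ n, ∀ C : List ℕ → κ, ∃ f : List ℕ,
    f.length = n ∧ RG a (a + 1) f ∧ ∃ q, ∀ x < a, C (f.map (sg a [x])) = q := by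
  obtain ⟨ι, _, hι⟩ := Combinatorics.Line.exists_mono_in_high_dimension (Fin a) κ
  let e := (Fintype.equivFin ι).symm
  refine ⟨Fintype.card ι, fun C => ?_⟩
  obtain ⟨l, q, hq⟩ := hι fun w => C (List.ofFn fun i => (w (e i)).val)
  refine ⟨List.ofFn fun i => (l.idxFun (e i)).elim a Fin.val, by simp, ?_, q, ?_⟩
  · apply RG_line
    · intro x hx
      rw [List.mem_ofFn] at hx
      obtain ⟨i, rfl⟩ := hx
      cases l.idxFun (e i) with
      | none => simp
      | some y => simpa using y.2.le
    · obtain ⟨i, hi⟩ := l.proper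
      rw [List.mem_ofFn]
      refine ⟨e.symm i, by simp [hi]⟩
  · intro x hx
    rw [← hq ⟨x, hx⟩]
    congr 1
    rw [List.map_ofFn]
    congr 1
    ext i
    simp only [Function.comp, Combinatorics.Line.apply_def]
    cases l.idxFun (e i) with
    | none => simp [sg]
    | some y => simp [sg]

theorem hj_cat (a K : ℕ) (κ : Type) [Finite κ] : ∃ n, ∀ d : List ℕ → κ, ∃ f : List ℕ,
    f.length = n ∧ RG a (a + 1) f ∧ ∃ F : List ℕ → κ, ∀ x < a, ∀ l : List ℕ, l.length ≤ K →
      (∀ y ∈ l, y < a) → d (f.map (sg a [x]) ++ l) = F l := by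
  have : Finite {l : List (Fin a) // l.length ≤ K} := (List.finite_length_le (Fin a) K).to_subtype
  obtain ⟨n, hn⟩ := hj_line a ({l : List (Fin a) // l.length ≤ K} → κ)
  refine ⟨n, fun d => ?_⟩
  obtain ⟨f, h1, h2, q, hq⟩ := hn fun w l => d (w ++ l.1.map Fin.val)
  refine ⟨f, h1, h2, fun l => if h : l.length ≤ K ∧ ∀ y ∈ l, y < a then
    q ⟨l.pmap (fun y hy => ⟨y, hy⟩) h.2, by simpa using h.1⟩ else d l, ?_⟩
  intro x hx l hl hla
  show _ = dite _ _ _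
  rw [dif_pos ⟨hl, hla⟩, ← hq x hx]
  simp [List.map_pmap]

theorem cat_subst {a x : ℕ} {f0 f1 g : List ℕ} (h0 : RG a (a + 1) f0) :
    (f0 ++ f1.map (sh a)).map (sg a (x :: g)) = f0.map (sg a [x]) ++ f1.map (sg a g) := by
  rw [List.map_append, List.map_map]
  congr 1
  · apply List.map_congr_left
    intro y hy
    have := h0.lt y hy
    by_cases hya : y < a
    · simp [sg, hya]
    · have : y = a := by omega
      simp [sg, this]
  · apply List.map_congr_left
    intro y hy
    by_cases hya : y < a
    · simp [sg, sh, hya]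
    · have h1 : y + 1 - a = (y - a) + 1 := by omega
      have h2 : ¬ (y + 1 < a) := by omega
      simp [sg, sh, hya, h2, h1]

def GR (k : ℕ) : Prop := ∀ (a m : ℕ) (κ : Type) [Finite κ], 0 < a → ∃ M, ∀ c : List ℕ → κ,
  ∃ f : List ℕ, f.length = M ∧ RG a (a + m) f ∧ ∃ q, ∀ g : List ℕ, g.length = m →
    RG a (a + k) g → c (f.map (sg a g)) = q

theorem GR_zero : GR 0 := by
  intro a m κ _ ha
  induction m with
  | zero =>
    refine ⟨0, fun c => ⟨[], rfl, rfl, c [], fun g _ _ => rfl⟩⟩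
  | succ m ih =>
    obtain ⟨K, hK⟩ := ih
    obtain ⟨n, hn⟩ := hj_cat a K κ
    refine ⟨n + K, fun c => ?_⟩
    obtain ⟨f0, h1, h2, F, hF⟩ := hn c
    obtain ⟨f1, h3, h4, q, hq⟩ := hK F
    refine ⟨f0 ++ f1.map (sh a), by simp [h1, h3], ?_, q, ?_⟩
    · have := h2.append (h4.shift le_rfl)
      exact this
    · intro g hg hga
      cases g with
      | nil => simp at hg
      | cons x g =>
        rw [cat_subst h2]
        have hx : x < a := hga.lt x (by simp)
        have hg' : RG a a g := RG_of_lt fun y hy => hga.lt y (by simp [hy])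
        have hgl : g.length = m := by simpa using hg
        rw [hF x hx, hq g hgl hg']
        · simp [h3]
        · exact (h4.subst hgl hg').lt

theorem GR_S {k : ℕ} (hk : GR k) (a N : ℕ) (ha : 0 < a) : ∀ (κ : Type) [Finite κ],
    ∃ M, ∀ c : List ℕ → κ, ∃ f : List ℕ, f.length = M ∧ RG a (a + N) f ∧ ∃ d : List ℕ → κ,
      ∀ g : List ℕ, g.length = N → RG a (a + (k + 1)) g →
        c (f.map (sg a g)) = d (g.takeWhile (· < a)) := by
  induction N with
  | zero =>
    intro κ _
    refine ⟨0, fun c => ⟨[], rfl, rfl, fun _ => c [], fun g _ _ => rfl⟩⟩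
  | succ N ih =>
    intro κ _
    obtain ⟨M', hM'⟩ := ih (Fin a → κ)
    obtain ⟨M1, hM1⟩ := hk (a + 1) M' κ (by omega)
    refine ⟨M1 + 1, fun c => ?_⟩
    obtain ⟨f1, h1, h2, q, hq⟩ := hM1 fun w => c (a :: w)
    obtain ⟨f2, h3, h4, d, hd⟩ := hM' fun h x => c ((a :: f1).map (sg a (x.val :: h)))
    have hF : RG a (a + (M' + 1)) (a :: f1) := Or.inr ⟨rfl, by convert h2 using 1; omega⟩
    have hG : RG a (a + (N + 1)) (a :: f2.map (sh a)) := Or.inr ⟨rfl, h4.shift le_rfl⟩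
    have hlen : (a :: f2.map (sh a)).length = M' + 1 := by simp [h3]
    refine ⟨(a :: f1).map (sg a (a :: f2.map (sh a))), by simp [h1], hF.subst hlen hG, 
      fun l => match l with
        | [] => q
        | x :: l => if h : x < a then d l ⟨x, h⟩ else q, ?_⟩
    intro g hg hga
    rw [sg_comp hF.lt hlen]
    cases g with
    | nil => simp at hg
    | cons x g =>
      have hgl : g.length = N := by simpa using hg
      have e1 : (a :: f2.map (sh a)).map (sg a (x :: g)) = x :: f2.map (sg a g) := by
        have h0 : RG a (a + 1) [a] := Or.inr ⟨rfl, rfl⟩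
        have := cat_subst (x := x) (f1 := f2) (g := g) h0
        simpa [sg] using this
      rw [e1]
      rcases hga with ⟨hx, hga⟩ | ⟨hx, hga⟩
      · have := congrFun (hd g hgl hga) ⟨x, hx⟩
        simp only at this
        rw [this]
        simp [hx]
      · subst hx
        have e2 : x :: f2.map (sg x g) = x :: (f2.map (sh x)).map (sg (x + 1) g) := by
          rw [List.map_map]
          congr 1
          apply List.map_congr_left
          intro y hy
          by_cases hya : y < x
          · have : y < x + 1 := by omega
            simp [sg, sh, hya, this]
          · have h1 : y + 1 - (x + 1) = (y - x) := by omega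
            simp [sg, sh, hya]
        have hga' : RG (x + 1) (x + 1 + k) g := by convert hga using 1; omega
        have h4' : RG (x + 1) (x + 1 + N) (f2.map (sh x)) := by
          convert h4.shift le_rfl using 1; omega
        have e3 : (x :: f1).map (sg x (x :: f2.map (sg x g))) =
            x :: f1.map (sg (x + 1) ((f2.map (sh x)).map (sg (x + 1) g))) := by
          rw [e2, List.map_cons]
          congr 1
          · simp [sg]
          · apply List.map_congr_left
            intro y hy
            rcases lt_trichotomy y x with h | h | h
            · have : y < x + 1 := by omega
              simp [sg, h, this]
            · subst h
              simp [sg]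
            · have h1 : y - x = (y - (x + 1)) + 1 := by omega
              have h2 : ¬ (y < x) := by omega
              have h3 : ¬ (y < x + 1) := by omega
              simp only [sg, h2, h3, if_false, h1, List.getD_cons_succ]
        rw [e3]
        have := hq _ (by simp [h3]) (h4'.subst hgl hga')
        rw [this]
        simp

theorem takeWhile_split {a : ℕ} {u v : List ℕ} (hu : ∀ x ∈ u, x < a) :
    (u ++ a :: v).takeWhile (· < a) = u := by
  rw [List.takeWhile_append_of_pos (by simpa using hu)]
  simp

theorem GR_H (a J : ℕ) (κ : Type) [Finite κ] [Nonempty κ] :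
    ∃ N, ∀ d : List ℕ → κ, ∃ f : List ℕ, f.length = N ∧ RG a (a + J) f ∧ ∃ e : ℕ → κ,
      ∀ u v : List ℕ, (∀ x ∈ u, x < a) → u.length + 1 + v.length = J →
        d ((f.map (sg a (u ++ a :: v))).takeWhile (· < a)) = e u.length := by
  induction J with
  | zero =>
    refine ⟨0, fun d => ⟨[], rfl, rfl, fun _ => d [], fun u v _ _ => rfl⟩⟩
  | succ J ih =>
    obtain ⟨K, hK⟩ := ih
    obtain ⟨n, hn⟩ := hj_cat a K κ
    refine ⟨n + K, fun d => ?_⟩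
    obtain ⟨f0, h1, h2, F, hF⟩ := hn d
    obtain ⟨f1, h3, h4, e, he⟩ := hK F
    refine ⟨f0 ++ f1.map (sh a), by simp [h1, h3], ?_,
      fun i => match i with
        | 0 => d (f0.takeWhile (· < a))
        | i + 1 => e i, ?_⟩
    · exact h2.append (h4.shift le_rfl)
    · intro u v hu hl
      cases u with
      | nil =>
        rw [List.nil_append, cat_subst h2]
        obtain ⟨u0, v0, hf0, hu0⟩ := h2.split le_rfl (by omega)
        have : f0.map (sg a [a]) = f0 := by
          conv_rhs => rw [← List.map_id f0]
          apply List.map_congr_left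
          intro y hy
          have := h2.lt y hy
          by_cases hya : y < a
          · simp [sg, hya]
          · have : y = a := by omega
            simp [sg, this]
        rw [this, hf0, List.append_assoc, List.cons_append, takeWhile_split hu0]
        simp only [List.length_nil]
        rw [takeWhile_split hu0]
      | cons x u =>
        have hx : x < a := hu x (by simp)
        rw [List.cons_append, cat_subst h2, List.takeWhile_append_of_pos, hF x hx]
        · rw [he u v (fun y hy => hu y (by simp [hy])) (by simp at hl; omega)]
          simp
        · refine (List.takeWhile_sublist _).length_le.trans ?_
          simp [h3]
        · intro y hy
          simpa using List.mem_takeWhile_imp hy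
        · have : RG a a (f0.map (sg a [x])) :=
            h2.subst rfl (RG_of_lt (by simpa using hx))
          simpa using this.lt

theorem pos_word (J : ℕ) : ∀ (a m : ℕ) (p : ℕ → Prop) [DecidablePred p], 0 < a →
    m ≤ Nat.count p J → ∃ h : List ℕ, h.length = J ∧ RG a (a + m) h ∧
      ∀ u x v, h = u ++ x :: v → x ≠ 0 → p u.length := by
  induction J with
  | zero =>
    intro a m p _ ha hm
    have : m = 0 := by simpa using hm
    subst this
    exact ⟨[], rfl, rfl, by simp⟩
  | succ J ih =>
    intro a m p _ ha hm
    rw [Nat.count_succ'] at hm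
    by_cases hc : p 0 ∧ m ≠ 0
    · obtain ⟨m, rfl⟩ := Nat.exists_eq_succ_of_ne_zero hc.2
      rw [if_pos hc.1] at hm
      obtain ⟨h, h1, h2, h3⟩ := ih (a + 1) m (fun i => p (i + 1)) (by omega) (by omega)
      refine ⟨a :: h, by simp [h1], Or.inr ⟨rfl, by convert h2 using 1; omega⟩, ?_⟩
      intro u x v hu hx
      cases u with
      | nil => exact hc.1
      | cons y u =>
        simp only [List.cons_append, List.cons.injEq] at hu
        exact h3 u x v hu.2 hx
    · obtain ⟨h, h1, h2, h3⟩ := ih a m (fun i => p (i + 1)) (by omega) (by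
        by_cases h0 : p 0
        · have : m = 0 := by tauto
          omega
        · rw [if_neg h0] at hm; omega)
      refine ⟨0 :: h, by simp [h1], Or.inl ⟨ha, h2⟩, ?_⟩
      intro u x v hu hx
      cases u with
      | nil => simp at hu; omega
      | cons y u =>
        simp only [List.cons_append, List.cons.injEq] at hu
        exact h3 u x v hu.2 hx

theorem GR_succ {k : ℕ} (hk : GR k) : GR (k + 1) := by
  classical
  intro a m κ _ ha
  rcases isEmpty_or_nonempty κ with hκ | hκ
  · exact ⟨0, fun c => hκ.elim (c [])⟩
  have := Fintype.ofFinite κ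
  obtain ⟨N, hN⟩ := GR_H a (Fintype.card κ * m) κ
  obtain ⟨M, hM⟩ := GR_S hk a N ha κ
  refine ⟨M, fun c => ?_⟩
  obtain ⟨f1, h1, h2, d, hd⟩ := hM c
  obtain ⟨f2, h3, h4, e, he⟩ := hN d
  obtain ⟨q, hq⟩ : ∃ q, m ≤ Nat.count (fun i => e i = q) (Fintype.card κ * m) := by
    obtain ⟨q, _, hq⟩ := Finset.exists_le_card_fiber_of_mul_le_card_of_maps_to
      (s := Finset.range (Fintype.card κ * m)) (t := Finset.univ) (f := e) (n := m)
      (by simp) Finset.univ_nonempty (by simp)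
    exact ⟨q, by rwa [Nat.count_eq_card_filter_range]⟩
  obtain ⟨h, h5, h6, h7⟩ := pos_word _ a m (fun i => e i = q) ha hq
  have h8 := h4.subst h5 h6
  have h9 : (f2.map (sg a h)).length = N := by simp [h3]
  refine ⟨f1.map (sg a (f2.map (sg a h))), by simp [h1], h2.subst h9 h8, q, ?_⟩
  intro g hg hga
  have h10 := h6.subst hg hga
  have h11 : (h.map (sg a g)).length = Fintype.card κ * m := by simp [h5]
  rw [sg_comp h2.lt h9, sg_comp h4.lt h5, hd _ (by simp [h3]) (h4.subst h11 h10)]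
  obtain ⟨u, v, huv, hu⟩ := h10.split le_rfl (by omega)
  rw [huv] at h11 ⊢
  rw [he u v hu (by simp at h11; omega)]
  rw [List.map_eq_append_iff] at huv
  obtain ⟨u', v', rfl, rfl, hv'⟩ := huv
  rw [List.map_eq_cons_iff] at hv'
  obtain ⟨x, v'', rfl, hx, rfl⟩ := hv'
  rw [List.length_map]
  refine h7 u' x v'' rfl ?_
  rintro rfl
  simp [sg, ha] at hx
  omega

theorem GR_all (k : ℕ) : GR k := by
  induction k with
  | zero => exact GR_zero
  | succ k ih => exact GR_succ ih

def lx {ι : Type} [LinearOrder ι] (u v : ι → Bool) : Prop :=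
  ∃ i, (∀ j < i, u j = v j) ∧ u i = false ∧ v i = true

theorem lx_iff {ι : Type} [LinearOrder ι] (u v : ι → Bool) : lx u v ↔ toLex u < toLex v := by
  constructor
  · rintro ⟨i, h1, h2, h3⟩
    exact ⟨i, h1, by simp [h2, h3]⟩
  · rintro ⟨i, h1, h2⟩
    refine ⟨i, h1, ?_⟩
    have h2' : u i < v i := h2
    revert h2'
    cases u i <;> cases v i <;> simp

def IsUp {X : Type} (P : X → X → Prop) (u : X → Bool) : Prop :=
  ∀ x y, P x y → u x = true → u y = true

theorem lx_asymm {ι : Type} [LinearOrder ι] {u v : ι → Bool} (h : lx u v) : ¬ lx v u := by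
  rw [lx_iff] at *
  exact lt_asymm h

theorem enum_up {X : Type} [Fintype X] [LinearOrder X] (P : X → X → Prop) :
    ∃ (k : ℕ) (ev : ℕ → X → Bool), ev 0 = (fun _ => false) ∧ (∀ i < 1 + k, IsUp P (ev i)) ∧
      (∀ u, IsUp P u → ∃ i < 1 + k, ev i = u) ∧
      (∀ i j, i < 1 + k → j < 1 + k → (lx (ev i) (ev j) ↔ i < j)) := by
  classical
  let S : Finset (Lex (X → Bool)) :=
    ((Finset.univ : Finset (X → Bool)).filter (IsUp P)).map toLex.toEmbedding
  have hS : ∀ u : X → Bool, toLex u ∈ S ↔ IsUp P u := by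
    intro u
    simp [S]
  have h0 : toLex (fun _ : X => false) ∈ S := by
    rw [hS]; intro x y _ h; exact h
  have hpos : 0 < S.card := Finset.card_pos.2 ⟨_, h0⟩
  let em := S.orderEmbOfFin rfl
  have hsurj : ∀ u, IsUp P u → ∃ i, em i = toLex u := by
    intro u hu
    have : toLex u ∈ Set.range em := by
      simp only [em, Finset.range_orderEmbOfFin]
      exact (hS u).2 hu
    exact this
  have hk : 1 + (S.card - 1) = S.card := by omega
  obtain ⟨ev, hev⟩ : ∃ ev : ℕ → X → Bool, ∀ i (h : i < S.card), ev i = ofLex (em ⟨i, h⟩) :=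
    ⟨fun i => if h : i < S.card then ofLex (em ⟨i, h⟩) else fun _ => false, fun i h => dif_pos h⟩
  refine ⟨S.card - 1, ev, ?_, ?_, ?_, ?_⟩
  · rw [hev 0 hpos]
    obtain ⟨i, hi⟩ := hsurj (fun _ => false) ((hS _).1 h0)
    have h1 : em ⟨0, hpos⟩ ≤ em i := em.monotone (Fin.mk_le_of_le_val (Nat.zero_le _))
    rcases h1.lt_or_eq with h1 | h1
    · rw [hi] at h1
      have h2 : lx (ofLex (em ⟨0, hpos⟩)) (fun _ => false) := (lx_iff _ _).2 h1
      obtain ⟨_, _, _, h⟩ := h2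
      simp at h
    · rw [h1, hi]; rfl
  · intro i hi
    rw [hk] at hi
    rw [hev i hi, ← hS]
    exact S.orderEmbOfFin_mem rfl _
  · intro u hu
    obtain ⟨i, hi⟩ := hsurj u hu
    refine ⟨i, by rw [hk]; exact i.2, ?_⟩
    rw [hev i i.2]
    simp [hi]
  · intro i j hi hj
    rw [hk] at hi hj
    rw [hev i hi, hev j hj, lx_iff, toLex_ofLex, toLex_ofLex]
    exact em.lt_iff_lt (a := ⟨i, hi⟩) (b := ⟨j, hj⟩)

theorem RG_of_rho {t ρ : ℕ → ℕ} {b : ℕ} (m : ℕ) : ∀ (s c : ℕ), s ≤ b →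
    (∀ p, c ≤ p → p < c + m → t p < b) →
    (∀ v, s ≤ v → v < b → c ≤ ρ v ∧ ρ v < c + m ∧ t (ρ v) = v) →
    (∀ v w, s ≤ v → v < w → w < b → ρ v < ρ w) →
    (∀ p, c ≤ p → p < c + m → s ≤ t p → ρ (t p) ≤ p) →
    RG s b ((List.range' c m).map t) := by
  induction m with
  | zero =>
    intro s c hsb h1 h2 h3 h4
    show s = b
    by_contra hne
    have := h2 s le_rfl (by omega)
    omega
  | succ m ih =>
    intro s c hsb h1 h2 h3 h4
    rw [List.range'_succ, List.map_cons]
    have htc := h1 c le_rfl (by omega)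
    by_cases hc : t c < s
    · refine Or.inl ⟨hc, ih s (c + 1) hsb (fun p hp hp' => h1 p (by omega) (by omega)) ?_ h3
        (fun p hp hp' => h4 p (by omega) (by omega))⟩
      intro v hv hv'
      obtain ⟨q1, q2, q3⟩ := h2 v hv hv'
      have : ρ v ≠ c := by
        intro h; rw [h] at q3; omega
      exact ⟨by omega, by omega, q3⟩
    · have hts : t c = s := by
        by_contra hne
        have e1 := h3 s (t c) le_rfl (by omega) htc
        have e2 := h4 c le_rfl (by omega) (by omega)
        have e3 := h2 s le_rfl (by omega)
        omega
      have hρ : ρ s = c := by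
        have e2 := h4 c le_rfl (by omega) (by omega)
        have e3 := h2 s le_rfl (by omega)
        rw [hts] at e2
        omega
      refine Or.inr ⟨hts, ih (s + 1) (c + 1) (by omega)
        (fun p hp hp' => h1 p (by omega) (by omega)) ?_ (fun v w hv => h3 v w (by omega))
        (fun p hp hp' h => h4 p (by omega) (by omega) (by omega))⟩
      intro v hv hv'
      obtain ⟨q1, q2, q3⟩ := h2 v (by omega) hv'
      have := h3 s v le_rfl (by omega) hv'
      exact ⟨by omega, by omega, q3⟩

/-- the map attached to a word -/
def cp {X : Type} (ev : ℕ → X → Bool) (M : ℕ) (w : List ℕ) (x : X) : Fin M → Bool :=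
  fun i => ev (w.getD i 0) x

theorem cp_orderPres {Y : Type} [Fintype Y] [LinearOrder Y] {P : Y → Y → Prop}
    (hP : IsStrictOrder Y P) (hext : ∀ x y, P x y → x < y) {k : ℕ} {ev : ℕ → Y → Bool}
    (h0 : ev 0 = fun _ => false) (h1 : ∀ i < 1 + k, IsUp P (ev i))
    (h2 : ∀ u, IsUp P u → ∃ i < 1 + k, ev i = u)
    (h3 : ∀ i j, i < 1 + k → j < 1 + k → (lx (ev i) (ev j) ↔ i < j))
    {M : ℕ} {f : List ℕ} (hl : f.length = M) (hf : RG 1 (1 + k) f) :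
    OrderPres P (· < ·) (fun u v : Fin M → Bool => u < v) lx (cp ev M f) := by
  classical
  have hlt : ∀ i : ℕ, f.getD i 0 < 1 + k := by
    intro i
    by_cases hi : i < f.length
    · rw [List.getD_eq_getElem _ _ hi]
      exact hf.lt _ (List.getElem_mem _)
    · rw [List.getD_eq_default _ _ (by omega)]; omega
  -- principal up-sets and their first occurrence
  have hprin : ∀ y : Y, ∃ i : Fin M, (∀ z, ev (f.getD i 0) z = true ↔ (y = z ∨ P y z)) ∧
      ∀ j < i, f.getD j 0 < f.getD i 0 := by
    intro y
    obtain ⟨p, hp, hpe⟩ := h2 (fun z => decide (y = z ∨ P y z)) (by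
      intro a b hab ha
      simp only [decide_eq_true_eq] at ha ⊢
      rcases ha with rfl | ha
      · exact Or.inr hab
      · exact Or.inr (hP.trans _ _ _ ha hab))
    have hp1 : 1 ≤ p := by
      rcases Nat.eq_zero_or_pos p with rfl | h
      · rw [h0] at hpe
        have := congrFun hpe y
        simp at this
      · exact h
    obtain ⟨u, v, huv, hu⟩ := hf.split hp1 hp
    have hul : u.length < M := by rw [← hl, huv]; simp
    have e1 : f.getD u.length 0 = p := by
      rw [huv]; simp [List.getD]
    refine ⟨⟨u.length, hul⟩, ?_, ?_⟩
    · intro z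
      simp only [e1, hpe, decide_eq_true_eq]
    · intro j hj
      have hj' : j.val < u.length := hj
      simp only [e1]
      rw [huv, List.getD_append _ _ _ _ hj', List.getD_eq_getElem _ _ hj']
      exact hu _ (List.getElem_mem _)
  have hL : ∀ x y : Y, x < y → lx (cp ev M f x) (cp ev M f y) := by
    intro x y hxy
    obtain ⟨i, hi, hi'⟩ := hprin y
    have hyi : cp ev M f y i = true := (hi y).2 (Or.inl rfl)
    have hxi : cp ev M f x i = false := by
      rw [Bool.eq_false_iff]
      intro h
      rcases (hi x).1 h with h | h
      · exact hxy.ne' h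
      · exact lt_asymm hxy (hext _ _ h)
    have hex : ∃ n : Fin M, cp ev M f x n ≠ cp ev M f y n := ⟨i, by rw [hxi, hyi]; simp⟩
    obtain ⟨n, hn, hmin⟩ := WellFounded.has_min (wellFounded_lt : WellFounded (α := Fin M) (· < ·))
      {n | cp ev M f x n ≠ cp ev M f y n} hex
    have hni : n ≤ i := not_lt.1 (hmin i (by show _ ≠ _; rw [hxi, hyi]; simp))
    refine ⟨n, fun j hj => by_contra fun h => hmin j h hj, ?_⟩
    have hxn : cp ev M f x n = false := by
      rcases hni.lt_or_eq with hni | rfl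
      · have hlt' := hi' n hni
        rw [Bool.eq_false_iff]
        intro h
        rw [← h3 _ _ (hlt _) (hlt _)] at hlt'
        obtain ⟨a, ha, ha1, ha2⟩ := hlt'
        have hya : y ≤ a := by
          rcases (hi a).1 ha2 with h | h
          · exact h.le
          · exact (hext _ _ h).le
        have := ha x (lt_of_lt_of_le hxy hya)
        have h' : ev (f.getD n 0) x = true := h
        rw [h'] at this
        have h'' : cp ev M f x i = true := this.symm
        rw [hxi] at h''
        simp at h''
      · exact hxi
    refine ⟨hxn, ?_⟩
    have hn' : cp ev M f x n ≠ cp ev M f y n := hn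
    rw [hxn] at hn'
    simpa using hn'.symm
  have hinj : ∀ x y, cp ev M f x = cp ev M f y → x = y := by
    intro x y h
    rcases lt_trichotomy x y with h' | h' | h'
    · obtain ⟨i, _, a, b⟩ := hL _ _ h'
      rw [h, b] at a; simp at a
    · exact h'
    · obtain ⟨i, _, a, b⟩ := hL _ _ h'
      rw [h, a] at b; simp at b
  refine ⟨fun x y => ?_, fun x y => ?_⟩
  · constructor
    · intro h
      refine lt_of_le_of_ne ?_ ?_
      · intro i
        have := h1 _ (hlt i) x y h
        show ev _ x ≤ ev _ y
        revert this
        cases ev (f.getD i 0) x <;> cases ev (f.getD i 0) y <;> simp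
      · intro he
        have := hinj _ _ he
        subst this
        exact hP.irrefl _ h
    · intro h
      obtain ⟨i, hi, _⟩ := hprin x
      have h5 : cp ev M f x i = true := (hi x).2 (Or.inl rfl)
      have h6 : cp ev M f x i ≤ cp ev M f y i := h.le i
      rw [h5] at h6
      have h7 : cp ev M f y i = true := by
        revert h6
        cases cp ev M f y i <;> simp
      rcases (hi y).1 h7 with rfl | h8
      · exact absurd h (lt_irrefl _)
      · exact h8
  · constructor
    · exact hL x y
    · intro h
      rcases lt_trichotomy x y with h' | h' | h'
      · exact h'
      · subst h'
        exact absurd h (lx_asymm h)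
      · exact absurd h (lx_asymm (hL _ _ h'))

theorem core (r : ℕ) (X Y : Type) [Fintype X] [Fintype Y] [LinearOrder X] [LinearOrder Y]
    (PX : X → X → Prop) (PY : Y → Y → Prop)
    (hPX : IsStrictOrder X PX) (hXext : ∀ x y, PX x y → x < y)
    (hPY : IsStrictOrder Y PY) (hYext : ∀ x y, PY x y → x < y) :
    ∃ (Z : Type) (_ : Fintype Z) (PZ LZ : Z → Z → Prop),
      IsStrictOrder Z PZ ∧ IsStrictTotalOrder Z LZ ∧ (∀ x y, PZ x y → LZ x y) ∧
      ∀ χ : Set Z → Fin r,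
        ∃ S : Set Z, IsCopy PY (· < ·) PZ LZ S ∧
          ∀ S₁ S₂ : Set Z,
            IsCopy PX (· < ·) PZ LZ S₁ → S₁ ⊆ S →
            IsCopy PX (· < ·) PZ LZ S₂ → S₂ ⊆ S →
            χ S₁ = χ S₂ := by
  classical
  obtain ⟨k, ev, h0, h1, h2, h3⟩ := enum_up PX
  obtain ⟨m, ew, g0, g1, g2, g3⟩ := enum_up PY
  obtain ⟨M, hM⟩ := GR_all k 1 m (Fin r) one_pos
  refine ⟨Fin M → Bool, inferInstance, fun u v => u < v, lx, inferInstance, ?_, ?_, ?_⟩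
  · have h : (lx : (Fin M → Bool) → _ → Prop) = fun u v => toLex u < toLex v := by
      funext u v; exact propext (lx_iff u v)
    rw [h]
    exact inferInstanceAs (IsStrictTotalOrder (Lex (Fin M → Bool)) (· < ·))
  · intro u v h
    rw [lx_iff]
    exact Pi.toLex_strictMono h
  intro χ
  obtain ⟨f, hfl, hf, q, hq⟩ := hM fun w => χ (Set.range (cp ev M w))
  have hop := cp_orderPres hPY hYext g0 g1 g2 g3 hfl hf
  refine ⟨Set.range (cp ew M f), ⟨_, hop, rfl⟩, ?_⟩
  suffices H : ∀ S₁ : Set (Fin M → Bool), IsCopy PX (· < ·) (fun u v => u < v) lx S₁ →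
      S₁ ⊆ Set.range (cp ew M f) → χ S₁ = q by
    intro S₁ S₂ a b c d
    rw [H S₁ a b, H S₂ c d]
  rintro S₁ ⟨φ, hφ, rfl⟩ hS
  have : ∀ x, ∃ y, cp ew M f y = φ x := fun x => hS ⟨x, rfl⟩
  choose e he using this
  have heP : ∀ x y, PX x y ↔ PY (e x) (e y) := by
    intro x y
    rw [hφ.1, hop.1, he, he]
  have heL : ∀ x y, x < y ↔ e x < e y := by
    intro x y
    refine (hφ.2 x y).trans ?_
    rw [← he, ← he]
    exact (hop.2 (e x) (e y)).symm
  have heinj : ∀ x y, e x = e y → x = y := by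
    intro x y h
    rcases lt_trichotomy x y with h' | h' | h'
    · rw [heL, h] at h'; exact absurd h' (lt_irrefl _)
    · exact h'
    · rw [heL, h] at h'; exact absurd h' (lt_irrefl _)
  -- pull back of up-sets
  have ht : ∀ p, ∃ i, p < 1 + m → i < 1 + k ∧ ev i = fun x => ew p (e x) := by
    intro p
    by_cases hp : p < 1 + m
    · obtain ⟨i, hi, hi'⟩ := h2 (fun x => ew p (e x)) fun x y hxy h =>
        g1 p hp _ _ ((heP x y).1 hxy) h
      exact ⟨i, fun _ => ⟨hi, hi'⟩⟩
    · exact ⟨0, fun h => absurd h hp⟩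
  choose t ht using ht
  have hρ : ∀ v, ∃ p, v < 1 + k → p < 1 + m ∧
      ∀ y, ew p y = true ↔ ∃ x, ev v x = true ∧ (e x = y ∨ PY (e x) y) := by
    intro v
    by_cases hv : v < 1 + k
    · obtain ⟨i, hi, hi'⟩ := g2 (fun y => decide (∃ x, ev v x = true ∧ (e x = y ∨ PY (e x) y))) (by
        intro a b hab ha
        simp only [decide_eq_true_eq] at ha ⊢
        obtain ⟨x, hx, ha⟩ := ha
        refine ⟨x, hx, Or.inr ?_⟩
        rcases ha with rfl | ha
        · exact hab
        · exact hPY.trans _ _ _ ha hab)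
      refine ⟨i, fun _ => ⟨hi, fun y => ?_⟩⟩
      rw [hi']; simp
    · exact ⟨0, fun h => absurd h hv⟩
  choose ρ hρ using hρ
  have inj_ev : ∀ i j, i < 1 + k → j < 1 + k → ev i = ev j → i = j := by
    intro i j hi hj h
    rcases lt_trichotomy i j with h' | h' | h'
    · rw [← h3 i j hi hj, h] at h'; exact absurd h' (lx_asymm h')
    · exact h'
    · rw [← h3 j i hj hi, h] at h'; exact absurd h' (lx_asymm h')
  have inj_ew : ∀ i j, i < 1 + m → j < 1 + m → ew i = ew j → i = j := by
    intro i j hi hj h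
    rcases lt_trichotomy i j with h' | h' | h'
    · rw [← g3 i j hi hj, h] at h'; exact absurd h' (lx_asymm h')
    · exact h'
    · rw [← g3 j i hj hi, h] at h'; exact absurd h' (lx_asymm h')
  have htρ : ∀ v, v < 1 + k → t (ρ v) = v := by
    intro v hv
    obtain ⟨hp, hpe⟩ := hρ v hv
    obtain ⟨hi, hie⟩ := ht _ hp
    apply inj_ev _ _ hi hv
    rw [hie]
    funext x
    rw [Bool.eq_iff_iff, hpe]
    constructor
    · rintro ⟨x', hx', h | h⟩
      · rwa [← heinj _ _ h]
      · exact h1 v hv _ _ ((heP _ _).2 h) hx'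
    · intro h
      exact ⟨x, h, Or.inl rfl⟩
  have t0 : t 0 = 0 := by
    obtain ⟨hi, hie⟩ := ht 0 (by omega)
    apply inj_ev _ _ hi (by omega)
    rw [hie, g0, h0]
  have hmono : ∀ v w, v < w → w < 1 + k → ρ v < ρ w := by
    intro v w hvw hw
    have hv : v < 1 + k := by omega
    obtain ⟨hp, hpe⟩ := hρ v hv
    obtain ⟨hp', hpe'⟩ := hρ w hw
    rw [← h3 v w hv hw] at hvw
    rw [← g3 _ _ hp hp']
    obtain ⟨x, hx, hx1, hx2⟩ := hvw
    refine ⟨e x, ?_, ?_, ?_⟩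
    · intro y hy
      rw [Bool.eq_iff_iff, hpe, hpe']
      have key : ∀ z, (e z = y ∨ PY (e z) y) → z < x := by
        intro z hz
        rw [heL]
        rcases hz with rfl | hz
        · exact hy
        · exact (hYext _ _ hz).trans hy
      constructor
      · rintro ⟨z, hz, hz'⟩
        exact ⟨z, by rw [← hx z (key z hz')]; exact hz, hz'⟩
      · rintro ⟨z, hz, hz'⟩
        exact ⟨z, by rw [hx z (key z hz')]; exact hz, hz'⟩
    · rw [Bool.eq_false_iff]
      intro h
      rw [hpe] at h
      obtain ⟨z, hz, h | h⟩ := h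
      · rw [heinj _ _ h, hx1] at hz; simp at hz
      · have := h1 v hv _ _ ((heP _ _).2 h) hz
        rw [hx1] at this; simp at this
    · rw [hpe']
      exact ⟨x, hx2, Or.inl rfl⟩
  have hρt : ∀ p, p < 1 + m → ρ (t p) ≤ p := by
    intro p hp
    obtain ⟨hi, hie⟩ := ht p hp
    obtain ⟨hp', hpe⟩ := hρ _ hi
    have hsub : ∀ y, ew (ρ (t p)) y = true → ew p y = true := by
      intro y hy
      rw [hpe] at hy
      obtain ⟨x, hx, hxy⟩ := hy
      rw [hie] at hx
      rcases hxy with rfl | hxy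
      · exact hx
      · exact g1 p hp _ _ hxy hx
    by_contra hlt
    rw [not_le, ← g3 _ _ hp hp'] at hlt
    obtain ⟨y, _, hy1, hy2⟩ := hlt
    rw [hsub y hy2] at hy1
    simp at hy1
  have hRG : RG 1 (1 + k) ((List.range' 1 m).map t) := by
    apply RG_of_rho (ρ := ρ) m 1 1 (by omega)
    · intro p _ hp
      exact (ht p hp).1
    · intro v hv hv'
      refine ⟨?_, (hρ v hv').1, htρ v hv'⟩
      rcases Nat.eq_zero_or_pos (ρ v) with h | h
      · have := htρ v hv'
        rw [h, t0] at this
        omega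
      · exact h
    · intro v w _ h1 h2
      exact hmono v w h1 h2
    · intro p _ hp _
      exact hρt p hp
  have := hq ((List.range' 1 m).map t) (by simp) hRG
  rw [← this]
  congr 2
  funext x i
  rw [← he]
  have hi : i.val < f.length := by rw [hfl]; exact i.2
  show ew (f.getD i 0) (e x) = ev ((f.map (sg 1 ((List.range' 1 m).map t))).getD i 0) x
  rw [List.getD_eq_getElem _ _ hi, List.getD_eq_getElem _ _ (by simpa using hi), List.getElem_map]
  have hb := hf.lt _ (List.getElem_mem hi)
  generalize f[i.val] = p at hb
  have e1 : sg 1 ((List.range' 1 m).map t) p = t p := by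
    rcases Nat.eq_zero_or_pos p with rfl | hp
    · simp [sg, t0]
    · have h5 : ¬ p < 1 := by omega
      have h6 : p - 1 < m := by omega
      have h7 : 1 + (p - 1) = p := by omega
      simp [sg, h5, h6, List.getD, h7]
  rw [e1, (ht p hb).2]

theorem ramsey_posets_one_extension
    (r : ℕ) (hr : 0 < r)
    (X Y : Type) (_ : Fintype X) (_ : Fintype Y)
    (PX LX : X → X → Prop) (PY LY : Y → Y → Prop)
    (hPX : IsStrictOrder X PX) (hLX : IsStrictTotalOrder X LX)
    (hXext : ∀ x y, PX x y → LX x y)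
    (hPY : IsStrictOrder Y PY) (hLY : IsStrictTotalOrder Y LY)
    (hYext : ∀ x y, PY x y → LY x y) :
    ∃ (Z : Type) (_ : Fintype Z) (PZ LZ : Z → Z → Prop),
      IsStrictOrder Z PZ ∧ IsStrictTotalOrder Z LZ ∧ (∀ x y, PZ x y → LZ x y) ∧
      ∀ χ : Set Z → Fin r,
        ∃ S : Set Z, IsCopy PY LY PZ LZ S ∧
          ∀ S₁ S₂ : Set Z,
            IsCopy PX LX PZ LZ S₁ → S₁ ⊆ S →
            IsCopy PX LX PZ LZ S₂ → S₂ ⊆ S →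
            χ S₁ = χ S₂ := by
  classical
  let iX : LinearOrder X := @linearOrderOfSTO X LX hLX (Classical.decRel _)
  let iY : LinearOrder Y := @linearOrderOfSTO Y LY hLY (Classical.decRel _)
  exact core r X Y PX PY hPX hXext hPY hYext
end

section
/- For every positive integer k and every pair of finite structures A = (X, P^X, (L_1^X, …, L_k^X)) and B = (Y, P^Y, (L_1^Y, …, L_k^Y)), where P^X (resp. P^Y) is a strict partial order on the finite set X (resp. Y) and each L_i^X (resp. L_i^Y) is a strict linear order on the same set extending the partial order, there exists a finite structure C = (Z, P^Z, (L_1^Z, …, L_k^Z)) of the same kind such that: for every 2-coloring of the set of copies of A in C, there exists a copy B̃ of B in C such that all copies of A inside B̃ receive the same color. -/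
/-- `π` is order preserving for the `PL^(k)` structures `(α, P, L)` and `(β, P', L')`. -/
def OrderPresK {k : ℕ} {α β : Type} (P : α → α → Prop) (L : Fin k → α → α → Prop)
    (P' : β → β → Prop) (L' : Fin k → β → β → Prop) (π : α → β) : Prop :=
  (∀ x y, P x y ↔ P' (π x) (π y)) ∧ ∀ i x y, L i x y ↔ L' i (π x) (π y)

/-- `S` is a copy of the `PL^(k)` structure `(α, P, L)` in `(β, P', L')`:
it is the image of an order preserving map. -/
def IsCopyK {k : ℕ} {α β : Type} (P : α → α → Prop) (L : Fin k → α → α → Prop)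
    (P' : β → β → Prop) (L' : Fin k → β → β → Prop) (S : Set β) : Prop :=
  ∃ π : α → β, OrderPresK P L P' L' π ∧ Set.range π = S

namespace PLK

/-- growth words -/
def G : ℕ → ℕ → List ℕ → Prop
  | a, m, [] => a = m
  | a, m, x :: l => (x < a ∧ G a m l) ∨ (x = a ∧ G (a + 1) m l)

def ev (a : ℕ) (t : List ℕ) (x : ℕ) : ℕ := if x < a then x else t.getD (x - a) x

lemma G_le {l : List ℕ} : ∀ {a m : ℕ}, G a m l → a ≤ m := by
  induction l with
  | nil => intro a m h; exact h.le
  | cons x l ih =>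
    intro a m h
    rcases h with ⟨_, h⟩ | ⟨_, h⟩
    · exact ih h
    · have := ih h; omega

lemma G_lt {l : List ℕ} : ∀ {a m : ℕ}, G a m l → ∀ x ∈ l, x < m := by
  induction l with
  | nil => intro a m h x hx; simp at hx
  | cons y l ih =>
    intro a m h x hx
    have hle := G_le h
    rcases h with ⟨h1, h⟩ | ⟨h1, h⟩
    · rcases List.mem_cons.1 hx with rfl | hx
      · omega
      · exact ih h x hx
    · have := G_le h
      rcases List.mem_cons.1 hx with rfl | hx
      · omega
      · exact ih h x hx

lemma G_const {l : List ℕ} {a : ℕ} (h : ∀ x ∈ l, x < a) : G a a l := by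
  induction l with
  | nil => rfl
  | cons y l ih =>
    exact Or.inl ⟨h y (by simp), ih fun x hx => h x (by simp [hx])⟩

lemma G_append_const {l r : List ℕ} {a m : ℕ} (h : ∀ x ∈ l, x < a) (hr : G a m r) :
    G a m (l ++ r) := by
  induction l with
  | nil => exact hr
  | cons y l ih =>
    exact Or.inl ⟨h y (by simp), ih fun x hx => h x (by simp [hx])⟩

lemma G_range'_append {n : ℕ} {r : List ℕ} : ∀ {a m : ℕ}, G (a + n) m r →
    G a m (List.range' a n ++ r) := by
  induction n with
  | zero => intro a m h; simpa using h
  | succ n ih =>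
    intro a m h
    rw [List.range'_succ]
    refine Or.inr ⟨rfl, ih ?_⟩
    have e : a + 1 + n = a + (n + 1) := by omega
    rwa [e]

lemma G_flatten {a n : ℕ} (L : List (List ℕ))
    (h : ∀ b ∈ L, (∀ x ∈ b, x < a) ∨ b = List.range' a n) (hm : List.range' a n ∈ L) :
    G a (a + n) L.flatten := by
  induction L with
  | nil => simp at hm
  | cons b L ih =>
    rw [List.flatten_cons]
    by_cases hb : b = List.range' a n
    · subst hb
      refine G_range'_append (G_const ?_)
      intro x hx
      obtain ⟨b, hbL, hxb⟩ := List.mem_flatten.1 hx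
      rcases h b (by simp [hbL]) with h1 | rfl
      · have := h1 x hxb; omega
      · rw [List.mem_range'_1] at hxb; exact hxb.2
    · have h1 := (h b (by simp)).resolve_right hb
      refine G_append_const h1 (ih (fun b hb => h b (by simp [hb])) ?_)
      rcases List.mem_cons.1 hm with h2 | h2
      · exact absurd h2.symm hb
      · exact h2

/-- general composition -/
lemma G_comp {s : List ℕ} : ∀ {b b' m : ℕ} {t : List ℕ} {e : ℕ → ℕ},
    G b (b + t.length) s → (∀ x < b, e x < b') → (∀ i (h : i < t.length), e (b + i) = t[i]) →
    G b' m t → G b' m (s.map e) := by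
  induction s with
  | nil =>
    intro b b' m t e hs he ht hG
    have : t.length = 0 := by simp only [G] at hs; omega
    rw [List.length_eq_zero_iff] at this
    subst this
    exact hG
  | cons x s ih =>
    intro b b' m t e hs he ht hG
    rcases hs with ⟨h1, hs⟩ | ⟨rfl, hs⟩
    · exact Or.inl ⟨he x h1, ih hs he ht hG⟩
    · have hle := G_le hs
      cases t with
      | nil => simp at hle
      | cons y t =>
        have hy : e x = y := ht 0 (by simp)
        have ht' : ∀ i (h : i < t.length), e (x + 1 + i) = t[i] := by
          intro i h
          have := ht (i + 1) (by simpa using h)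
          rw [show x + 1 + i = x + (i + 1) by omega, this]; simp
        have hs' : G (x + 1) (x + 1 + t.length) s := by
          have e : x + 1 + t.length = x + (y :: t).length := by simp; omega
          rwa [e]
        rcases hG with ⟨h1, hG⟩ | ⟨h1, hG⟩
        · refine Or.inl ⟨hy ▸ h1, ih hs' ?_ ht' hG⟩
          intro z hz
          rcases Nat.lt_succ_iff_lt_or_eq.1 hz with h | rfl
          · exact he z h
          · rw [hy]; exact h1
        · refine Or.inr ⟨hy.trans h1, ih hs' ?_ ht' hG⟩
          intro z hz
          rcases Nat.lt_succ_iff_lt_or_eq.1 hz with h | rfl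
          · exact (he z h).trans (Nat.lt_succ_self _)
          · rw [hy, h1]; exact Nat.lt_succ_self _

lemma ev_lt {a x : ℕ} (t : List ℕ) (h : x < a) : ev a t x = x := by simp [ev, h]

lemma ev_add {a i : ℕ} {t : List ℕ} (h : i < t.length) : ev a t (a + i) = t[i] := by
  simp [ev, h]

lemma G_ev {a n m : ℕ} {s t : List ℕ} (hs : G a (a + n) s) (hn : t.length = n)
    (ht : G a m t) : G a m (s.map (ev a t)) := by
  subst hn
  exact G_comp hs (fun x hx => by rwa [ev_lt t hx]) (fun i h => ev_add h) ht

lemma ev_comp {a x : ℕ} {u t : List ℕ} (h : x < a + u.length) :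
    ev a (u.map (ev a t)) x = ev a t (ev a u x) := by
  by_cases hx : x < a
  · simp [ev, hx]
  · obtain ⟨i, rfl⟩ := Nat.exists_eq_add_of_le (not_lt.1 hx)
    have hi : i < u.length := by omega
    rw [ev_add hi, ev_add (by simpa using hi)]; simp

lemma map_ev_comp {a n : ℕ} {s u t : List ℕ} (hs : G a (a + n) s) (hu : u.length = n) :
    s.map (ev a (u.map (ev a t))) = (s.map (ev a u)).map (ev a t) := by
  rw [List.map_map]
  refine List.map_congr_left fun x hx => ?_
  exact ev_comp (hu ▸ G_lt hs x hx)

def GR (a d : ℕ) : Prop := ∀ (κ : Type) [Finite κ] (n : ℕ), ∃ N, ∀ χ : List ℕ → κ,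
  ∃ s : List ℕ, s.length = N ∧ G a (a + n) s ∧ ∃ c, ∀ t : List ℕ, t.length = n →
    G a (a + d) t → χ (s.map (ev a t)) = c

lemma GR_zero (a : ℕ) : GR a 0 := by
  intro κ _ n
  obtain ⟨ι, _, hι⟩ := Combinatorics.Line.exists_mono_in_high_dimension (Fin n → Fin a) κ
  let K := Fintype.card ι
  let e : ι ≃ Fin K := Fintype.equivFin ι
  refine ⟨K * n, fun χ => ?_⟩
  obtain ⟨l, c, hc⟩ := hι fun f => χ (List.ofFn fun j : Fin K =>
    List.ofFn fun i => (f (e.symm j) i : ℕ)).flatten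
  let blk : Option (Fin n → Fin a) → List ℕ := fun o =>
    match o with
    | some v => List.ofFn fun i => (v i : ℕ)
    | none => List.range' a n
  have hblk : ∀ o, (blk o).length = n := by
    intro o; cases o <;> simp [blk]
  let s : List ℕ := (List.ofFn fun j : Fin K => blk (l.idxFun (e.symm j))).flatten
  refine ⟨s, ?_, ?_, c, ?_⟩
  · simp only [s, List.length_flatten, List.map_ofFn, Function.comp_def, hblk, List.sum_ofFn]
    simp
  · apply G_flatten
    · intro b hb
      rw [List.mem_ofFn] at hb
      obtain ⟨j, rfl⟩ := hb
      cases h : l.idxFun (e.symm j) with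
      | none => right; rfl
      | some v =>
        left; intro x hx
        simp only [blk, List.mem_ofFn] at hx
        obtain ⟨i, rfl⟩ := hx
        exact (v i).2
    · obtain ⟨i, hi⟩ := l.proper
      rw [List.mem_ofFn]
      exact ⟨e i, by simp [hi, blk]⟩
  · intro t ht hG
    have hlt := G_lt hG
    let τ : Fin n → Fin a := fun i => ⟨t[i]'(by omega), hlt _ (by simp)⟩
    rw [← hc τ]
    congr 1
    simp only [s, List.map_flatten, List.map_ofFn]
    congr 2
    funext j
    simp only [Function.comp, Combinatorics.Line.apply_def]
    cases h : l.idxFun (e.symm j) with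
    | none =>
      simp only [blk, Option.getD_none, τ]
      apply List.ext_getElem
      · simp
      · intro i h1 h2
        simp at h1
        simp [ev_add (show i < t.length by omega)]
    | some v =>
      simp only [blk, Option.getD_some, List.map_ofFn]
      congr 1
      funext i
      simp [ev_lt t (v i).2]

def sh (a x : ℕ) : ℕ := if x < a then x else x + 1

lemma G_sh {a : ℕ} {u : List ℕ} : ∀ {b m : ℕ}, a ≤ b → G b m u →
    G (b + 1) (m + 1) (u.map (sh a)) := by
  induction u with
  | nil => intro b m _ h; simp only [G] at h; subst h; rfl
  | cons x u ih =>
    intro b m hab h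
    rcases h with ⟨h1, h⟩ | ⟨h1, h⟩
    · refine Or.inl ⟨?_, ih hab h⟩
      simp only [sh]; split_ifs <;> omega
    · refine Or.inr ⟨?_, ih (by omega) h⟩
      simp only [sh]; split_ifs <;> omega

lemma ev_succ (a : ℕ) (v : List ℕ) (z : ℕ) : ev (a + 1) v z = ev a (a :: v) z := by
  simp only [ev]
  rcases lt_trichotomy z a with h | rfl | h
  · simp [h, Nat.lt_succ_of_lt h]
  · simp
  · obtain ⟨i, rfl⟩ := Nat.exists_eq_add_of_lt h
    rw [if_neg (by omega), if_neg (by omega)]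
    rw [show a + i + 1 - (a + 1) = i by omega, show a + i + 1 - a = i + 1 by omega]
    simp

lemma ev_self (a y : ℕ) (t : List ℕ) : ev a (y :: t) a = y := by simp [ev]

lemma ev_cons_succ (a y i : ℕ) (t : List ℕ) (h : i < t.length) :
    ev a (y :: t) (a + 1 + i) = t[i] := by
  have := ev_add (a := a) (i := i + 1) (t := y :: t) (by simpa using h)
  rw [show a + 1 + i = a + (i + 1) by omega, this]; simp

lemma ev_sh {a x y : ℕ} {t : List ℕ} (hx : x < a + t.length) :
    ev a (y :: t) (sh a x) = ev a t x := by
  by_cases h : x < a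
  · simp [sh, ev, h]
  · obtain ⟨i, rfl⟩ := Nat.exists_eq_add_of_le (not_lt.1 h)
    have hi : i < t.length := by omega
    rw [ev_add hi, sh, if_neg h, show a + i + 1 = a + 1 + i by omega, ev_cons_succ a y i t hi]

lemma key_comp {a n n1 y : ℕ} {s1 u2 t : List ℕ} (hs1 : G (a + 1) (a + 1 + n1) s1)
    (hu : u2.length = n1) (hu2 : G a (a + n) u2) (ht : t.length = n) :
    (a :: s1.map (ev a (a :: u2.map (sh a)))).map (ev a (y :: t))
      = y :: s1.map (ev a (y :: u2.map (ev a t))) := by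
  rw [List.map_cons, ev_self, List.map_map]
  congr 1
  refine List.map_congr_left fun z hz => ?_
  have hz := G_lt hs1 z hz
  simp only [Function.comp]
  rcases lt_trichotomy z a with h | rfl | h
  · simp [ev_lt _ h]
  · simp [ev_self]
  · obtain ⟨i, rfl⟩ := Nat.exists_eq_add_of_le (Nat.succ_le_of_lt h)
    have hi : i < u2.length := by
      have : a + 1 + i < a + 1 + n1 := hz
      omega
    have h1 := ev_cons_succ a a i (u2.map (sh a)) (by simpa using hi)
    have h2 := ev_cons_succ a y i (u2.map (ev a t)) (by simpa using hi)
    have h3 : ev a (y :: t) (sh a u2[i]) = ev a t u2[i] :=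
      ev_sh (ht ▸ G_lt hu2 _ (by simp))
    simp only [Nat.succ_eq_add_one]
    rw [h1, h2]
    simpa using h3

lemma lemA (a d : ℕ) (ih : GR (a + 1) d) : ∀ n, ∀ (κ : Type) [Finite κ], ∃ N,
    ∀ χ : List ℕ → κ, ∃ s : List ℕ, s.length = N ∧ G a (a + n) s ∧ ∃ c : List ℕ → κ,
      ∀ t : List ℕ, t.length = n → G a (a + (d + 1)) t →
        χ (s.map (ev a t)) = c (t.takeWhile (· < a)) := by
  intro n
  induction n with
  | zero =>
    intro κ _
    exact ⟨0, fun χ => ⟨[], rfl, rfl, fun _ => χ [], fun _ _ _ => rfl⟩⟩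
  | succ n ihn =>
    intro κ _
    obtain ⟨n1, h1⟩ := ihn (Fin a → κ)
    obtain ⟨N1, h2⟩ := ih κ n1
    refine ⟨N1 + 1, fun χ => ?_⟩
    obtain ⟨s1, hl1, hG1, c1, hc1⟩ := h2 fun u => χ (a :: u)
    obtain ⟨u2, hl2, hG2, c2, hc2⟩ :=
      h1 fun u => fun y : Fin a => χ (y :: s1.map (ev a (y :: u)))
    refine ⟨a :: s1.map (ev a (a :: u2.map (sh a))), by simp [hl1], ?_, fun w =>
      match w with
      | [] => c1
      | x :: w' => if h : x < a then c2 w' ⟨x, h⟩ else c1, ?_⟩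
    · refine Or.inr ⟨rfl, ?_⟩
      have hG3 := G_sh (le_refl a) hG2
      have := G_ev hG1 (t := u2.map (sh a)) (by simpa using hl2) hG3
      have e : s1.map (ev (a + 1) (u2.map (sh a))) = s1.map (ev a (a :: u2.map (sh a))) :=
        List.map_congr_left fun z _ => ev_succ _ _ _
      rw [e] at this
      exact this
    · intro t ht hG
      cases t with
      | nil => simp at ht
      | cons y t =>
        have ht : t.length = n := by simpa using ht
        rw [key_comp hG1 hl2 hG2 ht]
        rcases hG with ⟨hy, hG⟩ | ⟨rfl, hG⟩
        · have := congrFun (hc2 t ht hG) ⟨y, hy⟩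
          simp only at this
          rw [this]
          simp [hy]
        · have hv : G (y + 1) (y + 1 + d) (u2.map (ev y t)) := by
            have e : y + 1 + d = y + (d + 1) := by omega
            rw [e]
            subst ht
            exact G_comp hG2 (fun x hx => by rw [ev_lt _ hx]; omega) (fun i h => ev_add h) hG
          have := hc1 _ (by simpa using hl2) hv
          have e : s1.map (ev (y + 1) (u2.map (ev y t))) = s1.map (ev y (y :: u2.map (ev y t))) :=
            List.map_congr_left fun z _ => ev_succ _ _ _
          rw [e] at this
          simp [this]

lemma tw_stop {a D : ℕ} (hD : a ≤ D) (v : List ℕ) :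
    ¬ v.getD (v.takeWhile (· < a)).length D < a := by
  induction v with
  | nil => simpa using hD
  | cons x v ih =>
    by_cases h : x < a
    · simpa [h] using ih
    · simp only [List.takeWhile_cons, h, decide_false]
      simpa using h

/-- the prefix of a composite depends only on the prefix -/
lemma takeWhile_ev {a : ℕ} {v : List ℕ} {s : List ℕ} : ∀ {b m : ℕ}, G b m s →
    b ≤ a + (v.takeWhile (· < a)).length →
    (s.map (ev a v)).takeWhile (· < a) = (s.map (ev a (v.takeWhile (· < a)))).takeWhile (· < a) := by
  induction s with
  | nil => intros; rfl
  | cons x s ih =>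
    intro b m h hb
    have key : ∀ x < a + (v.takeWhile (· < a)).length,
        ev a v x = ev a (v.takeWhile (· < a)) x := by
      intro x hx
      by_cases h : x < a
      · simp [ev, h]
      · obtain ⟨i, rfl⟩ := Nat.exists_eq_add_of_le (not_lt.1 h)
        have hi : i < (v.takeWhile (· < a)).length := by omega
        have hi' : i < v.length := hi.trans_le (List.takeWhile_prefix _).length_le
        rw [ev_add hi, ev_add hi']
        exact ((List.takeWhile_prefix _).getElem hi).symm
    have hstp : ∀ x, x = a + (v.takeWhile (· < a)).length →
        ¬ ev a v x < a ∧ ¬ ev a (v.takeWhile (· < a)) x < a := by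
      rintro x rfl
      refine ⟨?_, by simp [ev]⟩
      have := tw_stop (a := a) (D := a + (v.takeWhile (· < a)).length) (by omega) v
      simp only [ev]
      rw [if_neg (by omega), Nat.add_sub_cancel_left]
      exact this
    by_cases hx : x < a + (v.takeWhile (· < a)).length
    · have hr : (s.map (ev a v)).takeWhile (· < a)
          = (s.map (ev a (v.takeWhile (· < a)))).takeWhile (· < a) := by
        rcases h with ⟨_, h⟩ | ⟨rfl, h⟩
        · exact ih h hb
        · exact ih h (by omega)
      simp only [List.map_cons, List.takeWhile_cons]
      rw [hr, key x hx]
    · have hx' : x = a + (v.takeWhile (· < a)).length := by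
        rcases h with ⟨_, h⟩ | ⟨rfl, h⟩ <;> omega
      obtain ⟨h1, h2⟩ := hstp x hx'
      simp [h1, h2]

lemma G_mem {s : List ℕ} : ∀ {a m l : ℕ}, G a m s → a ≤ l → l < m → l ∈ s := by
  induction s with
  | nil => intro a m l h h1 h2; simp only [G] at h; omega
  | cons x s ih =>
    intro a m l h h1 h2
    rcases h with ⟨_, h⟩ | ⟨rfl, h⟩
    · exact List.mem_cons_of_mem _ (ih h h1 h2)
    · by_cases e : l = x
      · simp [e]
      · exact List.mem_cons_of_mem _ (ih h (by omega) h2)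

lemma tw_append_of_mem {a x : ℕ} {u r : List ℕ} (hx : x ∈ u) (ha : ¬ x < a) :
    (u ++ r).takeWhile (· < a) = u.takeWhile (· < a) := by
  induction u with
  | nil => simp at hx
  | cons y u ih =>
    by_cases hy : y < a
    · have : x ∈ u := by
        rcases List.mem_cons.1 hx with rfl | h
        · exact absurd hy ha
        · exact h
      simp [hy, ih this]
    · simp [hy]

lemma tw_append_all {a : ℕ} {u r : List ℕ} (h : ∀ x ∈ u, x < a) :
    (u ++ r).takeWhile (· < a) = u ++ r.takeWhile (· < a) := by
  induction u with
  | nil => rfl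
  | cons y u ih =>
    have hy : y < a := h y (by simp)
    simp [hy, ih fun x hx => h x (by simp [hx])]

lemma ev_append {a x : ℕ} {t r : List ℕ} (h : x < a + t.length) : ev a (t ++ r) x = ev a t x := by
  by_cases hx : x < a
  · simp [ev, hx]
  · obtain ⟨i, rfl⟩ := Nat.exists_eq_add_of_le (not_lt.1 hx)
    have hi : i < t.length := by omega
    rw [ev_add hi, ev_add (by simp; omega)]
    simp [hi]

lemma lemB (a : ℕ) (κ : Type) [Finite κ] : ∀ M, ∃ n, ∀ c : List ℕ → κ, ∃ h : List ℕ,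
    h.length = n ∧ G a (a + M) h ∧ ∃ g : ℕ → κ, ∀ t : List ℕ, t.length = M →
      (t.takeWhile (· < a)).length < M →
      c ((h.map (ev a t)).takeWhile (· < a)) = g (t.takeWhile (· < a)).length := by
  intro M
  induction M with
  | zero => exact ⟨0, fun c => ⟨[], rfl, rfl, fun _ => c [], fun _ _ _ => rfl⟩⟩
  | succ M ih =>
    obtain ⟨n, hn⟩ := ih
    obtain ⟨n', hn'⟩ := GR_zero a κ n
    refine ⟨n' + 1, fun c => ?_⟩
    obtain ⟨s, hsl, hsG, k0, hk0⟩ := hn' c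
    obtain ⟨h', hl', hG', g', hg'⟩ := hn fun u => c ((s.map (ev a u)).takeWhile (· < a))
    have hGsh : G a (a + M) (s.map (ev a h')) := G_ev hsG hl' hG'
    refine ⟨s.map (ev a h') ++ [a + M], by simp [hsl], ?_, fun j => if j < M then g' j else k0, ?_⟩
    · have : ∀ (l : List ℕ) (b m : ℕ), G b m l → G b (m + 1) (l ++ [m]) := by
        intro l
        induction l with
        | nil => intro b m h; simp only [G] at h; subst h; exact Or.inr ⟨rfl, rfl⟩
        | cons x l ih =>
          intro b m h
          rcases h with ⟨h1, h⟩ | ⟨h1, h⟩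
          · exact Or.inl ⟨h1, ih _ _ h⟩
          · exact Or.inr ⟨h1, ih _ _ h⟩
      exact this _ _ _ hGsh
    · intro t ht htw
      obtain ⟨t0, y, rfl⟩ : ∃ t0 y, t = t0 ++ [y] := by
        have hne : t ≠ [] := by rintro rfl; simp at ht
        exact ⟨t.dropLast, t.getLast hne, (List.dropLast_append_getLast hne).symm⟩
      have ht0 : t0.length = M := by simpa using ht
      have e1 : (s.map (ev a h')).map (ev a (t0 ++ [y])) = s.map (ev a (h'.map (ev a t0))) := by
        rw [map_ev_comp hsG hl']
        refine List.map_congr_left fun x hx => ?_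
        exact ev_append (ht0 ▸ G_lt hGsh x hx)
      have e2 : ev a (t0 ++ [y]) (a + M) = y := by
        rw [ev_add (by simp; omega)]; simp [← ht0]
      rw [List.map_append, e1, List.map_singleton, e2]
      by_cases hall : ∀ x ∈ t0, x < a
      · have h1 : (t0 ++ [y]).takeWhile (· < a) = t0 ++ [y].takeWhile (· < a) := tw_append_all hall
        have hy : ¬ y < a := by
          intro hy
          rw [h1] at htw
          simp [hy, ht0] at htw
        have hGc : G a a (s.map (ev a (h'.map (ev a t0)))) :=
          G_ev hsG (by simpa using hl') (G_ev hG' ht0 (G_const hall))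
        rw [h1, tw_append_all (G_lt hGc)]
        simp only [List.takeWhile_cons, hy, decide_false]
        simp only [Bool.false_eq_true, if_false, List.append_nil, ht0, lt_irrefl]
        exact hk0 _ (by simpa using hl') (G_ev hG' ht0 (G_const hall))
      · push Not at hall
        obtain ⟨x, hx, hxa⟩ := hall
        obtain ⟨j, hj, rfl⟩ := List.getElem_of_mem hx
        have hmem : t0[j] ∈ s.map (ev a (h'.map (ev a t0))) := by
          rw [map_ev_comp hsG hl']
          refine List.mem_map.2 ⟨a + j, G_mem hGsh (by omega) (by omega), ev_add hj⟩
        rw [tw_append_of_mem hmem (not_lt.2 hxa), tw_append_of_mem hx (not_lt.2 hxa)]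
        have hlt : (t0.takeWhile (· < a)).length < M := by
          by_contra hcon
          have hp := List.takeWhile_prefix (l := t0) (fun x => decide (x < a))
          have := hp.eq_of_length (le_antisymm hp.length_le (by omega))
          have hx' : t0[j] ∈ t0.takeWhile (· < a) := this.symm ▸ hx
          have := List.mem_takeWhile_imp hx'
          simp at this
          omega
        simp only [if_pos hlt]
        rw [takeWhile_ev hsG (by omega)]
        exact hg' t0 ht0 hlt

lemma flagw : ∀ (M : ℕ) (f : ℕ → Prop) [DecidablePred f] (n b : ℕ), 0 < b → n ≤ Nat.count f M →
    ∃ q : List ℕ, q.length = M ∧ G b (b + n) q ∧ ∀ i, ¬ f i → q.getD i 0 = 0 := by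
  intro M
  induction M with
  | zero =>
    intro f _ n b hb hn
    have : n = 0 := by simpa using hn
    subst this
    exact ⟨[], rfl, rfl, by simp⟩
  | succ M ih =>
    intro f _ n b hb hn
    rw [Nat.count_succ'] at hn
    by_cases h : f 0 ∧ n ≠ 0
    · obtain ⟨n, rfl⟩ := Nat.exists_eq_succ_of_ne_zero h.2
      rw [if_pos h.1] at hn
      obtain ⟨q, h1, h2, h3⟩ := ih (fun k => f (k + 1)) n (b + 1) (by omega) (by omega)
      refine ⟨b :: q, by simp [h1], Or.inr ⟨rfl, ?_⟩, ?_⟩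
      · have e : b + (n + 1) = b + 1 + n := by omega
        simp only [Nat.succ_eq_add_one]
        rw [e]; exact h2
      · intro i hi
        cases i with
        | zero => exact absurd h.1 hi
        | succ i => simpa using h3 i hi
    · have hn' : n ≤ Nat.count (fun k => f (k + 1)) M := by
        by_cases h0 : f 0
        · have : n = 0 := by by_contra h1; exact h ⟨h0, h1⟩
          omega
        · rw [if_neg h0] at hn; omega
      obtain ⟨q, h1, h2, h3⟩ := ih (fun k => f (k + 1)) n b hb hn'
      refine ⟨0 :: q, by simp [h1], Or.inl ⟨hb, h2⟩, ?_⟩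
      intro i hi
      cases i with
      | zero => rfl
      | succ i => simpa using h3 i hi

lemma GR_succ (a d : ℕ) (ih : GR (a + 1) d) : GR a (d + 1) := by
  intro κ _ n
  rcases Nat.eq_zero_or_pos a with rfl | ha
  · obtain ⟨N, hN⟩ := lemA 0 d ih n κ
    refine ⟨N, fun χ => ?_⟩
    obtain ⟨s, h1, h2, c, hc⟩ := hN χ
    refine ⟨s, h1, h2, c [], fun t ht hG => ?_⟩
    rw [hc t ht hG]
    congr 1
    cases t <;> simp
  · classical
    obtain ⟨_⟩ := nonempty_fintype κ
    obtain ⟨nB, hB⟩ := lemB a κ (Fintype.card κ * n)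
    obtain ⟨N, hN⟩ := lemA a d ih nB κ
    refine ⟨N, fun χ => ?_⟩
    have : Nonempty κ := ⟨χ []⟩
    obtain ⟨s, h1, h2, c, hc⟩ := hN χ
    obtain ⟨h, hl, hG, g, hg⟩ := hB c
    obtain ⟨k, -, hk⟩ := Finset.exists_le_card_fiber_of_mul_le_card_of_maps_to
      (s := Finset.range (Fintype.card κ * n)) (t := (Finset.univ : Finset κ)) (f := g) (n := n)
      (fun _ _ => Finset.mem_univ _) Finset.univ_nonempty (by simp)
    rw [← Nat.count_eq_card_filter_range] at hk
    obtain ⟨q, hql, hqG, hq⟩ := flagw _ (fun x => g x = k) n a ha hk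
    have hGhq := G_ev hG hql hqG
    refine ⟨s.map (ev a (h.map (ev a q))), by simp [h1], G_ev h2 (by simpa using hl) hGhq, k, ?_⟩
    intro t ht hGt
    rw [← map_ev_comp h2 (by simpa using hl), ← map_ev_comp hG hql]
    have hqt : G a (a + (d + 1)) (q.map (ev a t)) := G_ev hqG ht hGt
    rw [hc _ (by simpa using hl) (G_ev hG (by simpa using hql) hqt)]
    have hlt : ((q.map (ev a t)).takeWhile (· < a)).length < Fintype.card κ * n := by
      by_contra hcon
      have hp := List.takeWhile_prefix (l := q.map (ev a t)) (fun x => decide (x < a))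
      have := hp.eq_of_length (le_antisymm hp.length_le (by simp [hql]; omega))
      have hx := G_mem hqt (le_refl a) (by omega)
      rw [← this] at hx
      have := List.mem_takeWhile_imp hx
      simp at this
    rw [hg _ (by simpa using hql) hlt]
    by_contra hne
    have h0 := hq _ hne
    have hst := tw_stop (a := a) (D := a) le_rfl (q.map (ev a t))
    apply hst
    rw [← hql] at hlt
    rw [List.getD_eq_getElem _ _ hlt] at h0
    rw [List.getD_eq_getElem _ _ (by simpa using hlt), List.getElem_map, h0, ev_lt _ ha]
    exact ha

theorem GR_all : ∀ d a, GR a d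
  | 0, a => GR_zero a
  | d + 1, a => GR_succ a d (GR_all d (a + 1))

lemma PR (d n : ℕ) : ∀ (k : ℕ) (κ : Type) [Finite κ], ∃ N : Fin k → ℕ,
    ∀ χ : (Fin k → List ℕ) → κ, ∃ s : Fin k → List ℕ,
      (∀ i, (s i).length = N i ∧ G 0 n (s i)) ∧ ∃ c, ∀ t : Fin k → List ℕ,
        (∀ i, (t i).length = n ∧ G 0 d (t i)) → χ (fun i => (s i).map (ev 0 (t i))) = c := by
  intro k
  induction k with
  | zero =>
    intro κ _
    refine ⟨fun _ => 0, fun χ => ⟨fun _ => [], fun i => i.elim0, χ (fun _ => []), fun t _ => ?_⟩⟩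
    congr 1
  | succ k ih =>
    intro κ _
    obtain ⟨N0, h0⟩ := GR_all d 0 κ n
    obtain ⟨N', h'⟩ := ih ((Fin N0 → Fin d) → κ)
    refine ⟨Fin.cons N0 N', fun χ => ?_⟩
    obtain ⟨s', hs', c', hc'⟩ := h' fun r f =>
      χ (Fin.cons (List.ofFn fun i => (f i : ℕ)) r)
    obtain ⟨ts, hts⟩ : ∃ ts : Fin k → List ℕ, ∀ t : Fin k → List ℕ,
        (∀ i, (t i).length = n ∧ G 0 d (t i)) → (∀ i, (ts i).length = n ∧ G 0 d (ts i)) := by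
      by_cases h : ∃ t : Fin k → List ℕ, (∀ i, (t i).length = n ∧ G 0 d (t i))
      · obtain ⟨t, ht⟩ := h
        exact ⟨t, fun _ _ => ht⟩
      · exact ⟨fun _ => [], fun t ht => absurd ⟨t, ht⟩ h⟩
    obtain ⟨s0, hl0, hG0, c, hc⟩ := h0 fun l =>
      χ (Fin.cons l fun i => (s' i).map (ev 0 (ts i)))
    rw [zero_add] at hG0
    simp only [zero_add] at hc
    refine ⟨Fin.cons s0 s', ?_, c, ?_⟩
    · intro i
      refine Fin.cases ?_ (fun i => ?_) i
      · exact ⟨hl0, hG0⟩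
      · exact hs' i
    · intro t ht
      have ht0 := ht 0
      have htl : ∀ i : Fin k, (t i.succ).length = n ∧ G 0 d (t i.succ) := fun i => ht i.succ
      have htss := hts _ htl
      have hGw : G 0 d (s0.map (ev 0 (t 0))) :=
        G_ev (n := n) (by rwa [zero_add]) ht0.1 ht0.2
      rw [← hc (t 0) ht0.1 ht0.2]
      let f : Fin N0 → Fin d := fun i =>
        ⟨(s0.map (ev 0 (t 0)))[i]'(by simp [hl0]), G_lt hGw _ (List.getElem_mem _)⟩
      have hf : (List.ofFn fun i => (f i : ℕ)) = s0.map (ev 0 (t 0)) := by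
        apply List.ext_getElem
        · simp [hl0]
        · intro i h1 h2
          simp [f]
      have e1 := congrFun (hc' (fun i => t i.succ) htl) f
      have e2 := congrFun (hc' ts htss) f
      have e3 := e1.trans e2.symm
      simp only [hf] at e3
      rw [← e3]
      congr 1
      funext i
      refine Fin.cases ?_ (fun i => ?_) i <;> simp

def lexr {ι : Type} (r : ι → ι → Prop) (S T : Set ι) : Prop :=
  ∃ x, x ∉ S ∧ x ∈ T ∧ ∀ y, r y x → (y ∈ S ↔ y ∈ T)

lemma lexr_sto {ι : Type} [Finite ι] (r : ι → ι → Prop) [IsStrictTotalOrder ι r] :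
    IsStrictTotalOrder (Set ι) (lexr r) where
  irrefl S := by rintro ⟨x, h1, h2, _⟩; exact h1 h2
  trans S T U := by
    rintro ⟨x, h1, h2, h3⟩ ⟨y, h4, h5, h6⟩
    rcases trichotomous_of r x y with h | rfl | h
    · exact ⟨x, h1, (h6 x h).1 h2, fun z hz => (h3 z hz).trans (h6 z (trans_of r hz h))⟩
    · exact absurd h2 h4
    · exact ⟨y, fun hy => h4 ((h3 y h).1 hy), h5,
        fun z hz => (h3 z (trans_of r hz h)).trans (h6 z hz)⟩
  trichotomous S T h1 h2 := by
    by_contra hne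
    have hex : ({x | ¬ (x ∈ S ↔ x ∈ T)} : Set ι).Nonempty := by
      by_contra h
      rw [Set.not_nonempty_iff_eq_empty] at h
      apply hne
      ext x
      by_contra hx
      have : x ∈ ({x | ¬ (x ∈ S ↔ x ∈ T)} : Set ι) := hx
      rw [h] at this
      exact this
    have wf : WellFounded r := Finite.wellFounded_of_trans_of_irrefl r
    obtain ⟨x, hx, hmin⟩ := wf.has_min _ hex
    have hmin' : ∀ y, r y x → (y ∈ S ↔ y ∈ T) := by
      intro y hy
      by_contra hc
      exact hmin y hc hy
    have hx : ¬ (x ∈ S ↔ x ∈ T) := hx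
    by_cases hS : x ∈ S
    · exact h2 ⟨x, fun hT => hx ⟨fun _ => hT, fun _ => hS⟩, hS, fun y hy => (hmin' y hy).symm⟩
    · have hT : x ∈ T := by
        by_contra hT
        exact hx ⟨fun h => absurd h hS, fun h => absurd h hT⟩
      exact h1 ⟨x, hS, hT, hmin'⟩

def IsUp {X : Type} (P : X → X → Prop) (U : Set X) : Prop := ∀ x y, P x y → x ∈ U → y ∈ U

lemma enum_rel (T : Type) [Finite T] (r : T → T → Prop) [IsStrictTotalOrder T r] :
    ∃ e : T ≃ Fin (Nat.card T), ∀ u v, e u < e v ↔ r u v := by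
  classical
  obtain ⟨_⟩ := nonempty_fintype T
  let _ : LinearOrder T := linearOrderOfSTO r
  let e := (Fintype.orderIsoFinOfCardEq T (k := Nat.card T) (by simp))
  exact ⟨e.symm.toEquiv, fun u v => e.symm.lt_iff_lt⟩

lemma enum_up {X : Type} [Finite X] (P L : X → X → Prop) [IsStrictTotalOrder X L] :
    ∃ f : ℕ → Set X,
      (∀ m < Nat.card {U : Set X // IsUp P U}, IsUp P (f m)) ∧
      (∀ U, IsUp P U → ∃ m < Nat.card {U : Set X // IsUp P U}, f m = U) ∧
      (∀ m < Nat.card {U : Set X // IsUp P U}, ∀ m' < Nat.card {U : Set X // IsUp P U},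
        (m < m' ↔ lexr L (f m) (f m'))) := by
  have hs := lexr_sto L
  have hs' : IsStrictTotalOrder {U : Set X // IsUp P U} (fun u v => lexr L u.1 v.1) :=
    { irrefl := fun u => hs.irrefl u.1
      trans := fun u v w => hs.trans u.1 v.1 w.1
      trichotomous := fun u v h1 h2 => Subtype.ext (hs.trichotomous u.1 v.1 h1 h2) }
  obtain ⟨e, he⟩ := enum_rel {U : Set X // IsUp P U} (fun u v => lexr L u.1 v.1)
  refine ⟨fun m => if h : m < Nat.card {U : Set X // IsUp P U} then (e.symm ⟨m, h⟩).1 else ∅,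
    ?_, ?_, ?_⟩
  · intro m hm
    simp only [dif_pos hm]
    exact (e.symm ⟨m, hm⟩).2
  · intro U hU
    refine ⟨e ⟨U, hU⟩, (e ⟨U, hU⟩).2, ?_⟩
    simp
  · intro m hm m' hm'
    simp only [dif_pos hm, dif_pos hm']
    rw [← he]
    simp

lemma G_of_fun {d : ℕ} : ∀ (n a : ℕ) (τ : ℕ → ℕ), a ≤ d → (∀ p < n, τ p < d) →
    (∀ l, a ≤ l → l < d → ∃ p < n, τ p = l) →
    (∀ p < n, ∀ l, a ≤ l → l < τ p → ∃ q < p, τ q = l) → G a d ((List.range n).map τ) := by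
  intro n
  induction n with
  | zero =>
    intro a τ had h1 h2 h3
    rcases had.lt_or_eq with h | h
    · obtain ⟨p, hp, _⟩ := h2 a le_rfl h; omega
    · exact h
  | succ n ih =>
    intro a τ had h1 h2 h3
    rw [List.range_succ_eq_map, List.map_cons, List.map_map]
    by_cases h0 : τ 0 < a
    · refine Or.inl ⟨h0, ih a (τ ∘ Nat.succ) had (fun p hp => h1 _ (by omega)) ?_ ?_⟩
      · intro l hl hld
        obtain ⟨p, hp, rfl⟩ := h2 l hl hld
        cases p with
        | zero => omega
        | succ p => exact ⟨p, by omega, rfl⟩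
      · intro p hp l hl hlt
        obtain ⟨q, hq, rfl⟩ := h3 (p + 1) (by omega) l hl hlt
        cases q with
        | zero => omega
        | succ q => exact ⟨q, by omega, rfl⟩
    · have e0 : τ 0 = a := by
        by_contra hne
        obtain ⟨q, hq, _⟩ := h3 0 (by omega) a le_rfl (by omega)
        omega
      have := h1 0 (by omega)
      refine Or.inr ⟨e0, ih (a + 1) (τ ∘ Nat.succ) (by omega) (fun p hp => h1 _ (by omega)) ?_ ?_⟩
      · intro l hl hld
        obtain ⟨p, hp, rfl⟩ := h2 l (by omega) hld
        cases p with
        | zero => omega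
        | succ p => exact ⟨p, by omega, rfl⟩
      · intro p hp l hl hlt
        obtain ⟨q, hq, rfl⟩ := h3 (p + 1) (by omega) l (by omega) hlt
        cases q with
        | zero => omega
        | succ q => exact ⟨q, by omega, rfl⟩

lemma G_first {s : List ℕ} : ∀ {a m : ℕ}, G a m s → ∀ p < s.length, ∀ l, a ≤ l →
    l < s.getD p 0 → ∃ q < p, s.getD q 0 = l := by
  induction s with
  | nil => intro a m h p hp; simp at hp
  | cons x s ih =>
    intro a m h p hp l hl hlt
    cases p with
    | zero =>
      have : l < x := by simpa using hlt
      rcases h with ⟨_, h⟩ | ⟨rfl, h⟩ <;> omega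
    | succ p =>
      have hp : p < s.length := by simpa using hp
      have hlt : l < s.getD p 0 := by simpa using hlt
      rcases h with ⟨_, h⟩ | ⟨rfl, h⟩
      · obtain ⟨q, hq, hh⟩ := ih h p hp l hl hlt
        exact ⟨q + 1, by omega, by simpa using hh⟩
      · by_cases e : l = x
        · exact ⟨0, by omega, by simp [e]⟩
        · obtain ⟨q, hq, hh⟩ := ih h p hp l (by omega) hlt
          exact ⟨q + 1, by omega, by simpa using hh⟩

/-- properties of the enumeration of upsets -/
structure IsEnum {X : Type} (P L : X → X → Prop) (d : ℕ) (f : ℕ → Set X) : Prop where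
  up : ∀ m < d, IsUp P (f m)
  surj : ∀ U, IsUp P U → ∃ m < d, f m = U
  lex : ∀ m < d, ∀ m' < d, (m < m' ↔ lexr L (f m) (f m'))

lemma occurs {n N : ℕ} {s : List ℕ} (hs : G 0 n s) (hN : s.length = N) {m : ℕ} (hm : m < n) :
    ∃ p : Fin N, s.getD p 0 = m := by
  obtain ⟨j, hj, h⟩ := List.getElem_of_mem (G_mem hs (Nat.zero_le m) hm)
  exact ⟨⟨j, hN ▸ hj⟩, by simp [hj, h]⟩

lemma getD_lt {n N : ℕ} {s : List ℕ} (hs : G 0 n s) (hN : s.length = N) (p : Fin N) :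
    s.getD p 0 < n := by
  have hp : (p : ℕ) < s.length := hN ▸ p.2
  rw [List.getD_eq_getElem _ _ hp]
  exact G_lt hs _ (List.getElem_mem _)

def decf {Y : Type} (N : ℕ) (f : ℕ → Set Y) (s : List ℕ) (y : Y) : Set (Fin N) :=
  {p | y ∈ f (s.getD p 0)}

lemma L_emb {Y : Type} [Finite Y] {P L : Y → Y → Prop} [IsStrictTotalOrder Y L]
    (hext : ∀ x y, P x y → L x y) {n N : ℕ} {f : ℕ → Set Y} (hf : IsEnum P L n f)
    {s : List ℕ} (hs : G 0 n s) (hN : s.length = N) {y y' : Y} (hy : L y y') :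
    lexr (· < ·) (decf N f s y) (decf N f s y') := by
  have hsto := lexr_sto (ι := Fin N) (· < ·)
  have hF : IsUp P {c | ¬ L c y'} := by
    intro x z hxz hx hz
    exact hx (trans_of L (hext _ _ hxz) hz)
  obtain ⟨m, hm, hfm⟩ := hf.surj _ hF
  have h1 : y' ∈ f m := by rw [hfm]; exact irrefl_of L y'
  have h2 : y ∉ f m := by rw [hfm]; exact fun h => h hy
  by_contra hcon
  by_cases hrev : lexr (· < ·) (decf N f s y') (decf N f s y)
  · obtain ⟨p, hp1, hp2, hp3⟩ := hrev
    have hp2 : y ∈ f (s.getD p 0) := hp2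
    have hpn := getD_lt hs hN p
    have hlt : m < s.getD p 0 := by
      rw [hf.lex _ hm _ hpn]
      have wf : WellFounded L := Finite.wellFounded_of_trans_of_irrefl L
      obtain ⟨z, hz, hmin⟩ := wf.has_min (f (s.getD p 0)) ⟨y, hp2⟩
      have hzy : L z y' := by
        rcases trichotomous_of L z y with h | rfl | h
        · exact trans_of L h hy
        · exact hy
        · exact absurd h (hmin y hp2)
      refine ⟨z, ?_, hz, ?_⟩
      · rw [hfm]; exact fun h => h hzy
      · intro c hc
        rw [hfm]
        constructor
        · intro h; exact absurd (trans_of L hc hzy) h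
        · intro h; exact absurd hc (hmin c h)
    obtain ⟨q, hq, hqm⟩ := G_first hs p (hN ▸ p.2) m (Nat.zero_le _) hlt
    have hqN : q < N := hq.trans p.2
    have := hp3 ⟨q, hqN⟩ hq
    simp only [decf, Set.mem_ofPred_eq, hqm] at this
    exact h2 (this.1 h1)
  · have := hsto.trichotomous _ _ hcon hrev
    obtain ⟨p, hp⟩ := occurs hs hN hm
    have h3 : p ∈ decf N f s y := by rw [this]; simp only [decf, Set.mem_ofPred_eq, hp]; exact h1
    simp only [decf, Set.mem_ofPred_eq, hp] at h3
    exact h2 h3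

lemma P_emb {Y : Type} {P L : Y → Y → Prop} [IsStrictOrder Y P]
    {n N : ℕ} {f : ℕ → Set Y} (hf : IsEnum P L n f)
    {s : List ℕ} (hs : G 0 n s) (hN : s.length = N) (y y' : Y) :
    P y y' ↔ decf N f s y ⊂ decf N f s y' := by
  have hU : ∀ z, IsUp P {c | z = c ∨ P z c} := by
    intro z x w hxw hx
    rcases hx with rfl | hx
    · exact Or.inr hxw
    · exact Or.inr (trans_of P hx hxw)
  constructor
  · intro h
    refine ⟨fun p hp => hf.up _ (getD_lt hs hN p) _ _ h hp, fun hsub => ?_⟩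
    obtain ⟨m, hm, hfm⟩ := hf.surj _ (hU y')
    obtain ⟨p, hp⟩ := occurs hs hN hm
    have h1 : p ∈ decf N f s y' := by
      simp [decf, -List.getD_eq_getElem?_getD, hp, hfm]
    have h2 := hsub h1
    simp only [decf, Set.mem_ofPred_eq, hp, hfm] at h2
    rcases h2 with rfl | h2
    · exact irrefl_of P _ h
    · exact irrefl_of P _ (trans_of P h h2)
  · intro h
    obtain ⟨m, hm, hfm⟩ := hf.surj _ (hU y)
    obtain ⟨p, hp⟩ := occurs hs hN hm
    have h1 : p ∈ decf N f s y := by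
      simp [decf, -List.getD_eq_getElem?_getD, hp, hfm]
    have h2 := h.1 h1
    simp only [decf, Set.mem_ofPred_eq, hp, hfm] at h2
    rcases h2 with rfl | h2
    · exact absurd h (ssubset_irrefl _)
    · exact h2

lemma grow {X Y : Type} [Finite X] [Finite Y] {P L : X → X → Prop} {P' L' : Y → Y → Prop}
    [IsStrictTotalOrder X L] [IsStrictTotalOrder Y L'] [IsStrictOrder Y P']
    (hext' : ∀ x y, P' x y → L' x y) {d n : ℕ} {f : ℕ → Set X} {f' : ℕ → Set Y}
    (hf : IsEnum P L d f) (hf' : IsEnum P' L' n f') (b : X → Y)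
    (hbP : ∀ x y, P x y ↔ P' (b x) (b y)) (hbL : ∀ x y, L x y ↔ L' (b x) (b y)) :
    ∃ t : List ℕ, t.length = n ∧ G 0 d t ∧ ∀ m < n, f (t.getD m 0) = b ⁻¹' (f' m) := by
  have hsto := lexr_sto L
  have hsto' := lexr_sto L'
  have hinj : ∀ m < d, ∀ m' < d, f m = f m' → m = m' := by
    intro m hm m' hm' h
    rcases lt_trichotomy m m' with h1 | h1 | h1
    · rw [hf.lex _ hm _ hm', h] at h1; exact absurd h1 (hsto.irrefl _)
    · exact h1
    · rw [hf.lex _ hm' _ hm, h] at h1; exact absurd h1 (hsto.irrefl _)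
  have hbinj : Function.Injective b := by
    intro x y h
    rcases trichotomous_of L x y with h1 | h1 | h1
    · rw [hbL, h] at h1; exact absurd h1 (irrefl_of L' _)
    · exact h1
    · rw [hbL, h] at h1; exact absurd h1 (irrefl_of L' _)
  have hpre : ∀ m, ∃ l, m < n → l < d ∧ f l = b ⁻¹' (f' m) := by
    intro m
    by_cases hm : m < n
    · obtain ⟨l, hl⟩ := hf.surj (b ⁻¹' (f' m))
        (fun x y hxy hx => hf'.up m hm _ _ ((hbP x y).1 hxy) hx)
      exact ⟨l, fun _ => hl⟩
    · exact ⟨0, fun h => absurd h hm⟩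
  choose τ hτ using hpre
  have hgen : ∀ V, IsUp P V → IsUp P' {c | ∃ v ∈ V, b v = c ∨ P' (b v) c} ∧
      b ⁻¹' {c | ∃ v ∈ V, b v = c ∨ P' (b v) c} = V := by
    intro V hV
    constructor
    · rintro x y hxy ⟨v, hv, rfl | h⟩
      · exact ⟨v, hv, Or.inr hxy⟩
      · exact ⟨v, hv, Or.inr (trans_of P' h hxy)⟩
    · ext x
      constructor
      · rintro ⟨v, hv, h | h⟩
        · exact hbinj h ▸ hv
        · exact hV _ _ ((hbP _ _).2 h) hv
      · intro hx
        exact ⟨x, hx, Or.inl rfl⟩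
  refine ⟨(List.range n).map τ, by simp, ?_, ?_⟩
  · apply G_of_fun n 0 τ (Nat.zero_le d) (fun p hp => (hτ p hp).1)
    · intro l _ hl
      obtain ⟨h1, h2⟩ := hgen (f l) (hf.up l hl)
      obtain ⟨p, hp, hfp⟩ := hf'.surj _ h1
      refine ⟨p, hp, hinj _ (hτ p hp).1 _ hl ?_⟩
      rw [(hτ p hp).2, hfp, h2]
    · intro p hp l _ hlt
      have hl : l < d := hlt.trans (hτ p hp).1
      obtain ⟨h1, h2⟩ := hgen (f l) (hf.up l hl)
      obtain ⟨q, hq, hfq⟩ := hf'.surj _ h1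
      have hql : τ q = l := by
        refine hinj _ (hτ q hq).1 _ hl ?_
        rw [(hτ q hq).2, hfq, h2]
      refine ⟨q, ?_, hql⟩
      rw [hf'.lex _ hq _ hp]
      by_contra hcon
      rw [hf.lex _ hl _ (hτ p hp).1, (hτ p hp).2] at hlt
      by_cases hrev : lexr L' (f' p) (f' q)
      · obtain ⟨b0, hb1, hb2, hb3⟩ := hrev
        have hb2' := hb2
        rw [hfq] at hb2'
        obtain ⟨v, hv, hvb⟩ := hb2'
        have hvq : b v ∈ f' q := by rw [hfq]; exact ⟨v, hv, Or.inl rfl⟩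
        have hvb : b v = b0 := by
          rcases hvb with h | h
          · exact h
          · exact absurd (hf'.up p hp _ _ h ((hb3 _ (hext' _ _ h)).2 hvq)) hb1
        subst hvb
        obtain ⟨x, hx1, hx2, hx3⟩ := hlt
        rcases trichotomous_of L v x with h | rfl | h
        · exact hb1 ((hx3 v h).1 hv)
        · exact hx1 hv
        · have : b x ∈ f' q := (hb3 _ ((hbL _ _).1 h)).1 hx2
          rw [hfq] at this
          have : x ∈ b ⁻¹' {c | ∃ v ∈ f l, b v = c ∨ P' (b v) c} := this
          rw [h2] at this
          exact hx1 this
      · have := hsto'.trichotomous _ _ hcon hrev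
        rw [← this, hfq, h2] at hlt
        exact hsto.irrefl _ hlt
  · intro m hm
    rw [List.getD_eq_getElem _ _ (by simpa using hm)]
    simpa using (hτ m hm).2

lemma decf_comp {X Y : Type} {n N : ℕ} {s t : List ℕ} {f : ℕ → Set X} {f' : ℕ → Set Y} {b : X → Y}
    (hs : G 0 n s) (hN : s.length = N) (ht : t.length = n)
    (h : ∀ m < n, f (t.getD m 0) = b ⁻¹' (f' m)) (x : X) :
    decf N f (s.map (ev 0 t)) x = decf N f' s (b x) := by
  ext p
  have hp : (p : ℕ) < s.length := hN ▸ p.2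
  have h1 := getD_lt hs hN p
  have h2 := h _ h1
  have e : (s.map (ev 0 t)).getD p 0 = t.getD (s.getD p 0) 0 := by
    have h3 : s[(p : ℕ)] < t.length := by
      rw [List.getD_eq_getElem _ _ hp] at h1; omega
    rw [List.getD_eq_getElem _ _ hp, List.getD_eq_getElem _ _ (by simpa using hp),
      List.getD_eq_getElem _ _ h3]
    simp [ev, h3]
  simp only [decf, Set.mem_ofPred_eq]
  rw [e, h2]
  rfl

end PLK

open PLK in
theorem ramsey_posets_k_extensions
    (k : ℕ) (hk : 0 < k)
    (X Y : Type) (_ : Fintype X) (_ : Fintype Y)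
    (PX : X → X → Prop) (LX : Fin k → X → X → Prop)
    (PY : Y → Y → Prop) (LY : Fin k → Y → Y → Prop)
    (hPX : IsStrictOrder X PX) (hLX : ∀ i, IsStrictTotalOrder X (LX i))
    (hXext : ∀ i x y, PX x y → LX i x y)
    (hPY : IsStrictOrder Y PY) (hLY : ∀ i, IsStrictTotalOrder Y (LY i))
    (hYext : ∀ i x y, PY x y → LY i x y) :
    ∃ (Z : Type) (_ : Fintype Z) (PZ : Z → Z → Prop) (LZ : Fin k → Z → Z → Prop),
      IsStrictOrder Z PZ ∧ (∀ i, IsStrictTotalOrder Z (LZ i)) ∧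
      (∀ i x y, PZ x y → LZ i x y) ∧
      ∀ χ : Set Z → Fin 2,
        ∃ S : Set Z, IsCopyK PY LY PZ LZ S ∧
          ∀ S₁ S₂ : Set Z,
            IsCopyK PX LX PZ LZ S₁ → S₁ ⊆ S →
            IsCopyK PX LX PZ LZ S₂ → S₂ ⊆ S →
            χ S₁ = χ S₂ := by
  classical
  obtain ⟨d, hd⟩ : ∃ d, ∀ i, ∃ f, IsEnum PX (LX i) d f :=
    ⟨_, fun i => by obtain ⟨f, h1, h2, h3⟩ := enum_up PX (LX i); exact ⟨f, h1, h2, h3⟩⟩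
  obtain ⟨n, hn⟩ : ∃ n, ∀ i, ∃ f, IsEnum PY (LY i) n f :=
    ⟨_, fun i => by obtain ⟨f, h1, h2, h3⟩ := enum_up PY (LY i); exact ⟨f, h1, h2, h3⟩⟩
  choose fX hfX using hd
  choose fY hfY using hn
  obtain ⟨N, hN⟩ := PR d n k (Fin 2)
  let Z : Type := ∀ i : Fin k, Set (Fin (N i))
  let i0 : Fin k := ⟨0, hk⟩
  let PZ : Z → Z → Prop := fun z w => ∀ i, z i ⊂ w i
  let LZ : Fin k → Z → Z → Prop := fun i z w =>
    lexr (· < ·) (z i) (w i) ∨ (z i = w i ∧ WellOrderingRel z w)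
  have hsto : ∀ i, IsStrictTotalOrder (Set (Fin (N i))) (lexr (· < ·)) := fun i => lexr_sto _
  have hLZ : ∀ i, IsStrictTotalOrder Z (LZ i) := by
    intro i
    refine { irrefl := ?irr, trans := ?tr, trichotomous := ?tri }
    case irr =>
      rintro z (h | ⟨_, h⟩)
      · exact (hsto i).irrefl _ h
      · exact irrefl_of WellOrderingRel z h
    case tr =>
      rintro z w v (h | ⟨e, h⟩) (h' | ⟨e', h'⟩)
      · exact Or.inl ((hsto i).trans _ _ _ h h')
      · left; rw [← e']; exact h
      · left; rw [e]; exact h'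
      · exact Or.inr ⟨e.trans e', trans_of WellOrderingRel h h'⟩
    case tri =>
      intro z w h h'
      have e : z i = w i :=
        (hsto i).trichotomous _ _ (fun h1 => h (Or.inl h1)) (fun h1 => h' (Or.inl h1))
      rcases trichotomous_of WellOrderingRel z w with h1 | h1 | h1
      · exact absurd (Or.inr ⟨e, h1⟩) h
      · exact h1
      · exact absurd (Or.inr ⟨e.symm, h1⟩) h'
  refine ⟨Z, Fintype.ofFinite Z, PZ, LZ, ?_, hLZ, ?_, ?_⟩
  · refine { irrefl := ?_, trans := ?_ }
    · intro z h; exact ssubset_irrefl _ (h i0)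
    · intro z w v h h' i; exact (h i).trans (h' i)
  · intro i z w h
    left
    by_contra hcon
    by_cases hrev : lexr (· < ·) (w i) (z i)
    · obtain ⟨p, h1, h2, _⟩ := hrev
      exact h1 ((h i).1 h2)
    · have := (hsto i).trichotomous _ _ hcon hrev
      have h1 := h i
      rw [this] at h1
      exact ssubset_irrefl _ h1
  · intro χ
    obtain ⟨s, hs, c, hc⟩ := hN fun t =>
      χ (Set.range fun x : X => (fun i => decf (N i) (fX i) (t i) x : Z))
    let φ : Y → Z := fun y i => decf (N i) (fY i) (s i) y
    have hφP : ∀ y y', PY y y' ↔ PZ (φ y) (φ y') := by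
      intro y y'
      constructor
      · intro h i; exact (P_emb (hfY i) (hs i).2 (hs i).1 y y').1 h
      · intro h; exact (P_emb (hfY i0) (hs i0).2 (hs i0).1 y y').2 (h i0)
    have hφL' : ∀ i y y', LY i y y' → LZ i (φ y) (φ y') := fun i y y' h =>
      Or.inl (L_emb (hYext i) (hfY i) (hs i).2 (hs i).1 h)
    have hφL : ∀ i y y', LY i y y' ↔ LZ i (φ y) (φ y') := by
      intro i y y'
      refine ⟨hφL' i y y', fun h => ?_⟩
      have := hLZ i
      rcases trichotomous_of (LY i) y y' with h1 | rfl | h1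
      · exact h1
      · exact absurd h (irrefl_of (LZ i) _)
      · exact absurd (trans_of (LZ i) h (hφL' i _ _ h1)) (irrefl_of (LZ i) _)
    have main : ∀ S₁ : Set Z, IsCopyK PX LX PZ LZ S₁ → S₁ ⊆ Set.range φ → χ S₁ = c := by
      rintro S₁ ⟨π, ⟨hπP, hπL⟩, rfl⟩ hsub
      have : ∀ x, ∃ y, φ y = π x := fun x => hsub ⟨x, rfl⟩
      choose b hb using this
      have hbP : ∀ x y, PX x y ↔ PY (b x) (b y) := by
        intro x y; rw [hφP, hb, hb]; exact hπP x y
      have hbL : ∀ i x y, LX i x y ↔ LY i (b x) (b y) := by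
        intro i x y; rw [hφL, hb, hb]; exact hπL i x y
      have := fun i => grow (hYext i) (hfX i) (hfY i) b hbP (hbL i)
      choose t ht1 ht2 ht3 using this
      rw [← hc t fun i => ⟨ht1 i, ht2 i⟩]
      congr 2
      funext x
      rw [← hb x]
      funext i
      exact (decf_comp (hs i).2 (hs i).1 (ht1 i) (ht3 i) x).symm
    exact ⟨Set.range φ, ⟨φ, ⟨hφP, hφL⟩, rfl⟩, fun S₁ S₂ h1 h1' h2 h2' =>
      (main S₁ h1 h1').trans (main S₂ h2 h2').symm⟩
end

section
/- Let k be a positive integer, let Z_i = (Z_i, P^{Z_i}, L^{Z_i}) for i ∈ [k] be finite sets each equipped with a strict partial order and a strict linear order extending it, and let A = (X, P^X, (L_1^X, …, L_k^X)) be a finite set with a strict partial order and k linear orders each extending it. Let C = (Z_1 × ⋯ × Z_k, <_C, (<_{lx_1}, …, <_{lx_k})) be the join of Z_1, …, Z_k. For each i ∈ [k], suppose π_i : X → Z_i is order preserving for (X, P^X, L_i^X) and Z_i. Then the map π : X → Z_1 × ⋯ × Z_k defined by π(x) = (π_1(x), …, π_k(x)) is order preserving for A and C; that is, its image is a copy of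 A in C. -/
/-- The product partial order on `C = Z 1 × ⋯ × Z k`:
`x <_C y` iff `x i (P i) y i` in every coordinate. -/
def prodLT {k : ℕ} {Z : Fin k → Type} (P : ∀ i, Z i → Z i → Prop)
    (x y : ∀ i, Z i) : Prop :=
  ∀ i, P i (x i) (y i)

open Fin.NatCast in
/-- The `i`-th shifted lexicographic order on `C = Z 1 × ⋯ × Z k`:
`x <_{lx_i} y` iff `x (i+δ) (L (i+δ)) y (i+δ)`, where `δ` is the least `j ≥ 0`
with `x (i+j) ≠ y (i+j)` (indices mod `k`). -/
def shiftLex {k : ℕ} [NeZero k] {Z : Fin k → Type} (L : ∀ i, Z i → Z i → Prop)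
    (i : Fin k) (x y : ∀ j, Z j) : Prop :=
  ∃ δ : ℕ, (∀ j < δ, x (i + (j : Fin k)) = y (i + (j : Fin k))) ∧
    x (i + (δ : Fin k)) ≠ y (i + (δ : Fin k)) ∧
    L (i + (δ : Fin k)) (x (i + (δ : Fin k))) (y (i + (δ : Fin k)))

/-- If `π i : X → Z i` is order preserving for `(X, P^X, L_i^X)` and `Z i` for each `i`,
then the diagonal map `x ↦ (π 1 x, …, π k x)` is order preserving for the `PL^(k)`
structure `A = (X, P^X, (L_1^X, …, L_k^X))` and the join `C` of `Z 1, …, Z k`;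
its image is a copy of `A` in `C`. -/
theorem diagonal_map_is_copy_in_join
    (k : ℕ) [NeZero k]
    (Z : Fin k → Type) (_ : ∀ i, Fintype (Z i))
    (PZ LZ : ∀ i, Z i → Z i → Prop)
    (hPZ : ∀ i, IsStrictOrder (Z i) (PZ i))
    (hLZ : ∀ i, IsStrictTotalOrder (Z i) (LZ i))
    (hZext : ∀ i x y, PZ i x y → LZ i x y)
    (X : Type) (_ : Fintype X)
    (PX : X → X → Prop) (LX : Fin k → X → X → Prop)
    (hPX : IsStrictOrder X PX)
    (hLX : ∀ i, IsStrictTotalOrder X (LX i))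
    (hXext : ∀ i x y, PX x y → LX i x y)
    (π : ∀ i, X → Z i)
    (hπ : ∀ i, OrderPres PX (LX i) (PZ i) (LZ i) (π i)) :
    OrderPresK PX LX (prodLT PZ) (shiftLex LZ) (fun x j => π j x) := by
  have irr : ∀ i z, ¬ LZ i z z := fun i z => by
    have := hLZ i
    exact irrefl_of (LZ i) z
  have inj : ∀ i x y, π i x = π i y → x = y := by
    intro i x y h
    have := hLX i
    rcases trichotomous_of (LX i) x y with h1 | h1 | h1
    · exact absurd (h ▸ ((hπ i).2 x y).1 h1) (irr i _)
    · exact h1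
    · exact absurd (h ▸ ((hπ i).2 y x).1 h1) (irr i _)
  refine ⟨fun x y => ⟨fun h i => ((hπ i).1 x y).1 h, fun h => ((hπ 0).1 x y).2 (h 0)⟩, ?_⟩
  intro i x y
  constructor
  · intro h
    have h2 := ((hπ i).2 x y).1 h
    refine ⟨0, fun j hj => absurd hj (Nat.not_lt_zero j), ?_, ?_⟩
    · intro he
      have hxy := inj _ x y he
      subst hxy
      exact irr i _ h2
    · simpa using ((hπ _).2 x y).1 (by simpa using h)
  · rintro ⟨δ, h1, h2, h3⟩
    rcases Nat.eq_zero_or_pos δ with h0 | h0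
    · subst h0
      have h4 := ((hπ _).2 x y).2 h3
      simpa using h4
    · have hxy := inj _ x y (h1 0 h0)
      subst hxy
      exact absurd rfl h2
end
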